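/- arXiv:1706.05444 — 9 statements merged into one kernel-verified Lean document; each statement's English description precedes it below -/
import Mathlib

section
/- Every nonnegative integer λ with λ ≡ 0 (mod 2) and λ ≢ 244 (mod 486) can be achieved as the character of an independent Stanley sequence. -/
/-- The next term of a Stanley sequence: the least integer greater than all current
elements such that the extended set remains free of nontrivial 3-term APs. -/
noncomputable def stanleyNext (S : Finset ℕ) : ℕ :=
  sInf {x : ℕ | (∀ s ∈ S, s < x) ∧ ThreeAPFree (insert x (S : Set ℕ))}

/-- Iteratively extend the initial set `A` greedily. -/
noncomputable def stanleyIter (A : Finset ℕ) : ℕ → Finset ℕ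
  | 0 => A
  | n + 1 => insert (stanleyNext (stanleyIter A n)) (stanleyIter A n)

/-- The set of terms of the Stanley sequence `S(A)`. -/
noncomputable def stanleySet (A : Finset ℕ) : Set ℕ :=
  ⋃ n, (stanleyIter A n : Set ℕ)

/-- The Stanley sequence `S(A)` as a sequence, listed in increasing order. -/
noncomputable def stanleySeq (A : Finset ℕ) (n : ℕ) : ℕ :=
  Nat.nth (· ∈ stanleySet A) n

/-- A sequence is independent with character `lam` if there is `χ` such that for all
`k ≥ χ` and `0 ≤ i < 2^k`, `a (2^k + i) = a (2^k) + a i` and `a (2^k) = 2*a (2^k - 1) - lam + 1`. -/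
def IsIndependent (a : ℕ → ℕ) (lam : ℕ) : Prop :=
  ∃ χ : ℕ, ∀ k ≥ χ, (∀ i < 2 ^ k, a (2 ^ k + i) = a (2 ^ k) + a i) ∧
    a (2 ^ k) + lam = 2 * a (2 ^ k - 1) + 1

/-- `lam` is achieved as the character of an independent Stanley sequence. -/
def IsCharacter (lam : ℕ) : Prop :=
  ∃ A : Finset ℕ, 0 ∈ A ∧ ThreeAPFree (A : Set ℕ) ∧
    IsIndependent (stanleySeq A) lam

/-- A set `A` of nonnegative integers is near-modular with respect to `N`. -/
def NearModular (A : Set ℕ) (N : ℕ) : Prop :=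
  0 ∈ A ∧
  (∀ x ∈ A, ∀ y ∈ A, ∀ z ∈ A,
    (x : ℤ) ≡ 2 * (y : ℤ) - (z : ℤ) [ZMOD (N : ℤ)] → x = y ∧ y = z) ∧
  (∀ x : ℤ, ∃ y ∈ A, ∃ z ∈ A, z ≤ y ∧ x ≡ 2 * (y : ℤ) - (z : ℤ) [ZMOD (N : ℤ)])

/-- A modular set mod `N`: a near-modular set contained in `{0, …, N-1}`. -/
def IsModularSet (A : Finset ℕ) (N : ℕ) : Prop :=
  (∀ a ∈ A, a < N) ∧ NearModular (A : Set ℕ) N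

/-- The Stanley sequence with term set `stanleySet A` is basic with basis `b`. -/
def IsBasicSequence (A : Finset ℕ) (b : ℕ → ℕ) : Prop :=
  (∃ α K : ℕ, ∀ k ≥ K, b k = α * 3 ^ k) ∧
  stanleySet A = {x : ℕ | ∃ F : Finset ℕ, x = ∑ k ∈ F, b k}

/-- The natural numbers all of whose ternary digits are `0` or `1`. -/
inductive TernaryZeroOne : ℕ → Prop
  | zero : TernaryZeroOne 0
  | three_mul {n : ℕ} : TernaryZeroOne n → TernaryZeroOne (3 * n)
  | three_mul_add_one {n : ℕ} : TernaryZeroOne n → TernaryZeroOne (3 * n + 1)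

namespace TernaryZeroOne

theorem mod_three_and_div_three {n : ℕ} (h : TernaryZeroOne n) :
    n % 3 ≠ 2 ∧ TernaryZeroOne (n / 3) := by
  cases h with
  | zero => exact ⟨by decide, zero⟩
  | @three_mul m h => exact ⟨by omega, by rwa [show 3 * m / 3 = m by omega]⟩
  | @three_mul_add_one m h => exact ⟨by omega, by rwa [show (3 * m + 1) / 3 = m by omega]⟩

theorem iff_mod_three_and_div_three (n : ℕ) :
    TernaryZeroOne n ↔ n % 3 ≠ 2 ∧ TernaryZeroOne (n / 3) := by
  refine ⟨mod_three_and_div_three, fun ⟨h, hn⟩ => ?_⟩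
  have hmod : n % 3 = 0 ∨ n % 3 = 1 := by omega
  rcases hmod with h0 | h1
  · rw [show n = 3 * (n / 3) by omega]
    exact hn.three_mul
  · rw [show n = 3 * (n / 3) + 1 by omega]
    exact hn.three_mul_add_one

theorem eq_of_add_eq {a : ℕ} : ∀ {b c : ℕ}, TernaryZeroOne a → TernaryZeroOne b →
    TernaryZeroOne c → a + c = 2 * b → a = b := by
  induction a using Nat.strong_induction_on with
  | _ a ih =>
    intro b c ha hb hc h
    obtain ⟨ha3, ha'⟩ := ha.mod_three_and_div_three
    obtain ⟨hb3, hb'⟩ := hb.mod_three_and_div_three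
    obtain ⟨hc3, hc'⟩ := hc.mod_three_and_div_three
    rcases Nat.eq_zero_or_pos a with rfl | hpos
    · by_contra hne
      have key : ∀ n, TernaryZeroOne n → TernaryZeroOne (2 * n) → n = 0 := by
        intro n
        induction n using Nat.strong_induction_on with
        | _ n ihn =>
          intro h1 h2
          obtain ⟨h13, h1'⟩ := h1.mod_three_and_div_three
          obtain ⟨h23, h2'⟩ := h2.mod_three_and_div_three
          by_contra hn
          rw [show 2 * n / 3 = 2 * (n / 3) by omega] at h2'
          have := ihn (n / 3) (by omega) h1' h2'
          omega
      have := key b hb (by rwa [← h, Nat.zero_add])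
      omega
    · have := ih (a / 3) (by omega) ha' hb' hc' (by omega)
      omega

theorem exists_add_eq_two_mul (q : ℕ) :
    ∃ s t, TernaryZeroOne s ∧ TernaryZeroOne t ∧ t ≤ s ∧ q + t = 2 * s := by
  induction q using Nat.strong_induction_on with
  | _ q ih =>
    rcases Nat.eq_zero_or_pos q with rfl | hpos
    · exact ⟨0, 0, zero, zero, le_rfl, rfl⟩
    · obtain ⟨s, t, hs, ht, hts, h⟩ := ih (q / 3) (by omega)
      have hmod : q % 3 = 0 ∨ q % 3 = 1 ∨ q % 3 = 2 := by omega
      rcases hmod with h0 | h1 | h2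
      · exact ⟨3 * s, 3 * t, hs.three_mul, ht.three_mul, by omega, by omega⟩
      · exact ⟨3 * s + 1, 3 * t + 1, hs.three_mul_add_one, ht.three_mul_add_one, by omega,
          by omega⟩
      · exact ⟨3 * s + 1, 3 * t, hs.three_mul_add_one, ht.three_mul, by omega, by omega⟩

theorem pow_add_iff (j : ℕ) : ∀ {x : ℕ}, x < 3 ^ j →
    (TernaryZeroOne (3 ^ j + x) ↔ TernaryZeroOne x) := by
  induction j with
  | zero =>
    intro x hx
    obtain rfl : x = 0 := by simpa using hx
    exact ⟨fun _ => zero, fun _ => three_mul_add_one zero⟩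
  | succ j ih =>
    intro x hx
    rw [pow_succ] at hx ⊢
    rw [iff_mod_three_and_div_three, iff_mod_three_and_div_three x,
      show (3 ^ j * 3 + x) / 3 = 3 ^ j + x / 3 by omega, ih (by omega),
      show (3 ^ j * 3 + x) % 3 = x % 3 by omega]

theorem not_two_mul_pow_add (j : ℕ) : ∀ {x : ℕ}, x < 3 ^ j →
    ¬ TernaryZeroOne (2 * 3 ^ j + x) := by
  induction j with
  | zero =>
    intro x hx h
    obtain rfl : x = 0 := by simpa using hx
    exact h.mod_three_and_div_three.1 (by norm_num)
  | succ j ih =>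
    intro x hx h
    rw [pow_succ] at hx h
    have h' := h.mod_three_and_div_three.2
    rw [show (2 * (3 ^ j * 3) + x) / 3 = 2 * 3 ^ j + x / 3 by omega] at h'
    exact ih (by omega) h'

end TernaryZeroOne

open Classical in
/-- If every late natural number is the third term of a progression in the progression-free set
`T`, then the greedy extension of a long enough initial segment of `T` is `T` itself. -/
theorem exists_stanleySet_eq {T : Set ℕ} {X : ℕ} (h0 : 0 ∈ T) (hfree : ThreeAPFree T)
    (hcover : ∀ x ≥ X, ∃ y ∈ T, ∃ z ∈ T, z ≤ y ∧ x + z = 2 * y) :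
    ∃ A : Finset ℕ, 0 ∈ A ∧ ThreeAPFree (A : Set ℕ) ∧ stanleySet A = T := by
  have hunbdd : ∀ n, ∃ t ∈ T, n < t := by
    intro n
    obtain ⟨y, hy, z, -, hzy, h⟩ := hcover (X + (2 * n + 2)) (by omega)
    exact ⟨y, hy, by omega⟩
  let seg : ℕ → Finset ℕ := fun u => (Finset.range (u + 1)).filter (· ∈ T)
  have mem_seg : ∀ {u x}, x ∈ seg u ↔ x ≤ u ∧ x ∈ T := by
    intro u x
    simp [seg]
  have seg_sub : ∀ u, (seg u : Set ℕ) ⊆ T := fun u x hx => (mem_seg.1 hx).2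
  have next : ∀ u ∈ T, X ≤ u → ∃ t ∈ T, u < t ∧
      insert (stanleyNext (seg u)) (seg u) = seg t := by
    intro u hu hXu
    have hex : ∃ t, t ∈ T ∧ u < t := hunbdd u
    obtain ⟨htT, hut⟩ := Nat.find_spec hex
    have hmin : ∀ x ∈ T, u < x → Nat.find hex ≤ x := fun x hx hux => Nat.find_min' hex ⟨hx, hux⟩
    set t := Nat.find hex
    have hnext : stanleyNext (seg u) = t := by
      refine IsLeast.csInf_eq ⟨⟨fun s hs => ?_, ?_⟩, ?_⟩
      · exact (mem_seg.1 hs).1.trans_lt hut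
      · exact hfree.mono (Set.insert_subset htT (seg_sub u))
      · rintro x ⟨hx, hxfree⟩
        by_contra! hxt
        have hux : u < x := hx u (mem_seg.2 ⟨le_rfl, hu⟩)
        have hxT : x ∉ T := fun h => absurd (hmin x h hux) (by omega)
        obtain ⟨y, hy, z, hz, hzy, h⟩ := hcover x (by omega)
        have hyx : y ≠ x := fun h => hxT (h ▸ hy)
        have hyu : y ≤ u := by
          by_contra! h'
          have := hmin y hy h'
          omega
        have := hxfree (a := z) (b := y) (c := x)
          (Set.mem_insert_of_mem _ (mem_seg.2 ⟨by omega, hz⟩))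
          (Set.mem_insert_of_mem _ (mem_seg.2 ⟨hyu, hy⟩)) (Set.mem_insert _ _) (by omega)
        omega
    refine ⟨t, htT, hut, ?_⟩
    rw [hnext]
    ext x
    rw [Finset.mem_insert, mem_seg, mem_seg]
    constructor
    · rintro (rfl | ⟨hx, hxT⟩)
      · exact ⟨le_rfl, htT⟩
      · exact ⟨by omega, hxT⟩
    · rintro ⟨hx, hxT⟩
      by_cases hxu : x ≤ u
      · exact Or.inr ⟨hxu, hxT⟩
      · exact Or.inl (le_antisymm hx (hmin x hxT (by omega)))
  obtain ⟨u, hu, hXu⟩ := hunbdd X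
  have iter : ∀ n, ∃ v ∈ T, u + n ≤ v ∧ stanleyIter (seg u) n = seg v := by
    intro n
    induction n with
    | zero => exact ⟨u, hu, le_rfl, rfl⟩
    | succ n ih =>
      obtain ⟨v, hv, huv, h⟩ := ih
      obtain ⟨t, ht, hvt, h'⟩ := next v hv (by omega)
      exact ⟨t, ht, by omega, by rw [stanleyIter, h, h']⟩
  refine ⟨seg u, mem_seg.2 ⟨Nat.zero_le _, h0⟩, hfree.mono (seg_sub u), ?_⟩
  ext x
  rw [stanleySet, Set.mem_iUnion]
  constructor
  · rintro ⟨n, hn⟩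
    obtain ⟨v, -, -, h⟩ := iter n
    rw [h] at hn
    exact seg_sub v hn
  · intro hx
    obtain ⟨v, -, hv, h⟩ := iter x
    exact ⟨x, by rw [h]; exact mem_seg.2 ⟨by omega, hx⟩⟩

/-- The set of `x` whose residue modulo `N` is in `A` and whose quotient by `N` has only ternary
digits `0` and `1`. -/
def ternaryExtension (A : Finset ℕ) (N : ℕ) : Set ℕ :=
  {x | x % N ∈ A ∧ TernaryZeroOne (x / N)}

theorem mem_ternaryExtension_of_lt {A : Finset ℕ} {N x : ℕ} (hx : x < N) :
    x ∈ ternaryExtension A N ↔ x ∈ A := by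
  simp [ternaryExtension, Nat.mod_eq_of_lt hx, Nat.div_eq_of_lt hx, TernaryZeroOne.zero]

theorem add_mem_ternaryExtension_iff {A : Finset ℕ} {N j x : ℕ} (hx : x < N * 3 ^ j) :
    N * 3 ^ j + x ∈ ternaryExtension A N ↔ x ∈ ternaryExtension A N := by
  have hN : 0 < N := Nat.pos_of_mul_pos_right (Nat.zero_lt_of_lt hx)
  simp only [ternaryExtension, Set.mem_ofPred_eq, Nat.mul_add_mod, Nat.mul_add_div hN]
  rw [TernaryZeroOne.pow_add_iff j (Nat.div_lt_of_lt_mul hx)]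

theorem two_mul_add_notMem_ternaryExtension {A : Finset ℕ} {N j x : ℕ} (hx : x < N * 3 ^ j) :
    N * 3 ^ j + (N * 3 ^ j + x) ∉ ternaryExtension A N := by
  have hN : 0 < N := Nat.pos_of_mul_pos_right (Nat.zero_lt_of_lt hx)
  rintro ⟨-, h⟩
  rw [show N * 3 ^ j + (N * 3 ^ j + x) = N * (2 * 3 ^ j) + x by ring, Nat.mul_add_div hN] at h
  exact TernaryZeroOne.not_two_mul_pow_add j (Nat.div_lt_of_lt_mul hx) h

open Classical in
theorem count_ternaryExtension {A : Finset ℕ} {N k : ℕ} (hlt : ∀ a ∈ A, a < N)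
    (hcard : A.card = 2 ^ k) (j : ℕ) :
    Nat.count (· ∈ ternaryExtension A N) (N * 3 ^ j) = 2 ^ (k + j) := by
  induction j with
  | zero =>
    rw [pow_zero, mul_one, Nat.count_eq_card_filter_range, Nat.add_zero, ← hcard]
    congr 1
    ext x
    rw [Finset.mem_filter, Finset.mem_range]
    exact ⟨fun ⟨h, h'⟩ => (mem_ternaryExtension_of_lt h).1 h',
      fun h => ⟨hlt x h, (mem_ternaryExtension_of_lt (hlt x h)).2 h⟩⟩
  | succ j ih =>
    rw [show N * 3 ^ (j + 1) = N * 3 ^ j + (N * 3 ^ j + N * 3 ^ j) by ring, Nat.count_add,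
      Nat.count_add, ih]
    have h1 : Nat.count (fun x => N * 3 ^ j + x ∈ ternaryExtension A N) (N * 3 ^ j)
        = 2 ^ (k + j) := by
      rw [← ih, Nat.count_eq_card_filter_range, Nat.count_eq_card_filter_range]
      congr 1
      exact Finset.filter_congr fun x hx => add_mem_ternaryExtension_iff (Finset.mem_range.1 hx)
    have h2 : Nat.count (fun x => N * 3 ^ j + (N * 3 ^ j + x) ∈ ternaryExtension A N)
        (N * 3 ^ j) = 0 := by
      rw [Nat.count_eq_card_filter_range, Finset.card_eq_zero, Finset.filter_eq_empty_iff]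
      exact fun x hx => two_mul_add_notMem_ternaryExtension (Finset.mem_range.1 hx)
    rw [h1, h2]
    ring

open Classical in
theorem nth_ternaryExtension_add {A : Finset ℕ} {N k : ℕ} (hlt : ∀ a ∈ A, a < N)
    (hcard : A.card = 2 ^ k) {j i : ℕ} (hi : i < 2 ^ (k + j)) :
    Nat.nth (· ∈ ternaryExtension A N) (2 ^ (k + j) + i) =
      N * 3 ^ j + Nat.nth (· ∈ ternaryExtension A N) i := by
  set p : ℕ → Prop := (· ∈ ternaryExtension A N) with hp
  have hcount : Nat.count p (N * 3 ^ j) = 2 ^ (k + j) := count_ternaryExtension hlt hcard j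
  have hfin : ∀ hf : (Set.ofPred p).Finite, i < hf.toFinset.card := fun hf => by
    refine hi.trans_le ?_
    rw [← hcount, Nat.count_eq_card_filter_range]
    exact Finset.card_le_card fun x hx => hf.mem_toFinset.2 (Finset.mem_filter.1 hx).2
  have hxlt : Nat.nth p i < N * 3 ^ j := Nat.nth_lt_of_lt_count (by rwa [hcount])
  have hx : p (Nat.nth p i) := Nat.nth_mem i hfin
  have hci : Nat.count p (Nat.nth p i) = i := Nat.count_nth hfin
  have hcount' : Nat.count p (N * 3 ^ j + Nat.nth p i) = 2 ^ (k + j) + i := by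
    rw [Nat.count_add, hcount]
    congr 1
    conv_rhs => rw [← hci]
    rw [Nat.count_eq_card_filter_range, Nat.count_eq_card_filter_range]
    congr 1
    exact Finset.filter_congr fun x hx' =>
      add_mem_ternaryExtension_iff ((Finset.mem_range.1 hx').trans hxlt)
  rw [← hcount']
  exact Nat.nth_count ((add_mem_ternaryExtension_iff hxlt).2 hx)

namespace NearModular

theorem pos {A : Set ℕ} {N : ℕ} {M : ℕ} (h : NearModular A N) (hM : ∀ a ∈ A, a ≤ M) :
    0 < N := by
  rcases Nat.eq_zero_or_pos N with rfl | hN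
  · obtain ⟨y, hy, z, -, -, hx⟩ := h.2.2 (2 * M + 1)
    have := hM y hy
    simp [Int.modEq_iff_dvd] at hx
    omega
  · exact hN

/-- Passing from modulus `N` to modulus `3 * N` by adjoining a translate. -/
theorem union_translate {A : Finset ℕ} {N : ℕ} (hN : 0 < N) (h : NearModular (A : Set ℕ) N) :
    NearModular ((A ∪ A.image (N + ·) : Finset ℕ) : Set ℕ) (3 * N) ∧
      (A ∪ A.image (N + ·)).card = 2 * A.card := by
  obtain ⟨h0, hfree, hcover⟩ := h
  have hmem : ∀ x : ℕ, x ∈ ((A ∪ A.image (N + ·) : Finset ℕ) : Set ℕ) ↔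
      ∃ a ∈ A, ∃ e : ℤ, (e = 0 ∨ e = 1) ∧ (x : ℤ) = a + N * e := by
    intro x
    simp only [Finset.coe_union, Finset.coe_image, Set.mem_union, Finset.mem_coe, Set.mem_image]
    constructor
    · rintro (hx | ⟨a, ha, rfl⟩)
      · exact ⟨x, hx, 0, by simp⟩
      · exact ⟨a, ha, 1, by simp, by push_cast; ring⟩
    · rintro ⟨a, ha, e, rfl | rfl, hx⟩
      · left
        rwa [show x = a by simpa using hx]
      · exact Or.inr ⟨a, ha, by zify; rw [hx]; ring⟩
  have hNz : (N : ℤ) ≠ 0 := by exact_mod_cast hN.ne'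
  refine ⟨⟨?_, ?_, ?_⟩, ?_⟩
  · exact (hmem 0).2 ⟨0, h0, 0, by simp⟩
  · intro x hx y hy z hz hxyz
    obtain ⟨a, ha, e, he, hxe⟩ := (hmem x).1 hx
    obtain ⟨b, hb, f, hf, hyf⟩ := (hmem y).1 hy
    obtain ⟨c, hc, g, hg, hzg⟩ := (hmem z).1 hz
    rw [Int.modEq_iff_dvd] at hxyz
    push_cast at hxyz
    obtain ⟨d, hd⟩ := hxyz
    rw [hxe, hyf, hzg] at hd
    obtain ⟨rfl, rfl⟩ := hfree a ha b hb c hc (Int.modEq_iff_dvd.2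
      ⟨3 * d - 2 * f + g + e, by linear_combination hd⟩)
    have key : 2 * f - g - e = 3 * d := mul_left_cancel₀ hNz (by linear_combination hd)
    have : e = f ∧ f = g := by omega
    obtain ⟨rfl, rfl⟩ := this
    omega
  · intro x
    obtain ⟨y, hy, z, hz, hzy, hx⟩ := hcover x
    obtain ⟨d, hd⟩ := Int.modEq_iff_dvd.1 hx
    have hlift : ∀ e f : ℤ, (e = 0 ∨ e = 1) → (f = 0 ∨ f = 1) → f ≤ e → 3 ∣ d + 2 * e - f →
        ∃ y ∈ ((A ∪ A.image (N + ·) : Finset ℕ) : Set ℕ),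
        ∃ z ∈ ((A ∪ A.image (N + ·) : Finset ℕ) : Set ℕ), z ≤ y ∧
          x ≡ 2 * (y : ℤ) - (z : ℤ) [ZMOD ((3 * N : ℕ) : ℤ)] := by
      rintro e f he hf hfe ⟨c, hc⟩
      have hy' : (y : ℤ) + N * e = ((y + N * e.toNat : ℕ) : ℤ) := by
        push_cast; rw [Int.toNat_of_nonneg (by omega)]
      have hz' : (z : ℤ) + N * f = ((z + N * f.toNat : ℕ) : ℤ) := by
        push_cast; rw [Int.toNat_of_nonneg (by omega)]
      refine ⟨_, (hmem _).2 ⟨y, hy, e, he, hy'.symm⟩, _, (hmem _).2 ⟨z, hz, f, hf, hz'.symm⟩,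
        add_le_add hzy (Nat.mul_le_mul_left _ (by omega)), ?_⟩
      rw [← hy', ← hz', Int.modEq_iff_dvd]
      exact ⟨c, by push_cast; linear_combination hd + N * hc⟩
    have hd3 : d % 3 = 0 ∨ d % 3 = 1 ∨ d % 3 = 2 := by omega
    rcases hd3 with h3 | h3 | h3
    · exact hlift 0 0 (by simp) (by simp) le_rfl (by omega)
    · exact hlift 1 0 (by simp) (by simp) (by simp) (by omega)
    · exact hlift 1 1 (by simp) (by simp) le_rfl (by omega)
  · rw [Finset.card_union_of_disjoint, Finset.card_image_of_injective _ (add_right_injective N),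
      two_mul]
    rw [Finset.disjoint_left]
    intro x hx hx'
    obtain ⟨a, ha, rfl⟩ := Finset.mem_image.1 hx'
    have := hfree a ha (N + a) hx a ha (Int.modEq_iff_dvd.2 ⟨2, by push_cast; ring⟩)
    omega

/-- A modular set with `2 ^ k` elements yields an independent Stanley sequence. -/
theorem isCharacter_of_lt {A : Finset ℕ} {N k M lam : ℕ} (h : NearModular (A : Set ℕ) N)
    (hcard : A.card = 2 ^ k) (hM : IsGreatest (A : Set ℕ) M) (hMN : M < N)
    (hlam : lam + N = 2 * M + 1) : IsCharacter lam := by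
  classical
  have hN : 0 < N := by omega
  have hlt : ∀ a ∈ A, a < N := fun a ha => (hM.2 ha).trans_lt hMN
  obtain ⟨h0, hfree, hcover⟩ := h
  set T := ternaryExtension A N with hT
  have hT0 : 0 ∈ T := (mem_ternaryExtension_of_lt hN).2 h0
  have hTfree : ThreeAPFree T := by
    rintro x ⟨hx, hx'⟩ y ⟨hy, hy'⟩ z ⟨hz, hz'⟩ hxyz
    have hx0 : (N : ℤ) * (x / N : ℕ) + (x % N : ℕ) = x := by exact_mod_cast Nat.div_add_mod x N
    have hy0 : (N : ℤ) * (y / N : ℕ) + (y % N : ℕ) = y := by exact_mod_cast Nat.div_add_mod y N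
    have hz0 : (N : ℤ) * (z / N : ℕ) + (z % N : ℕ) = z := by exact_mod_cast Nat.div_add_mod z N
    have hxyz' : (x : ℤ) + z = y + y := by exact_mod_cast hxyz
    obtain ⟨h1, h2⟩ := hfree _ hx _ hy _ hz (Int.modEq_iff_dvd.2
      ⟨(x / N : ℕ) + (z / N : ℕ) - 2 * (y / N : ℕ),
        by linear_combination 2 * hy0 - hx0 - hz0 - hxyz'⟩)
    have hNz : (N : ℤ) ≠ 0 := by exact_mod_cast hN.ne'
    have hdiv : ((x / N : ℕ) : ℤ) + (z / N : ℕ) = 2 * (y / N : ℕ) := by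
      refine mul_left_cancel₀ hNz ?_
      rw [h1] at hx0
      rw [← h2] at hz0
      linear_combination hx0 + hz0 - 2 * hy0 + hxyz'
    rw [← Nat.div_add_mod x N, h1, TernaryZeroOne.eq_of_add_eq hx' hy' hz' (by exact_mod_cast hdiv),
      Nat.div_add_mod]
  have hTcover : ∀ x ≥ 2 * N, ∃ y ∈ T, ∃ z ∈ T, z ≤ y ∧ x + z = 2 * y := by
    intro x hx
    obtain ⟨a, ha, b, hb, hba, hab⟩ := hcover x
    obtain ⟨d, hd⟩ := Int.modEq_iff_dvd.1 hab
    have haN := hlt a ha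
    have hbN := hlt b hb
    have hd0 : d ≤ 0 := by
      by_contra! hpos
      have : 0 < (N : ℤ) * d := by positivity
      omega
    obtain ⟨q, rfl⟩ : ∃ q : ℕ, d = -q := ⟨(-d).toNat, by omega⟩
    obtain ⟨s, t, hs, ht, hts, hq⟩ := TernaryZeroOne.exists_add_eq_two_mul q
    refine ⟨N * s + a, ?_, N * t + b, ?_, add_le_add (Nat.mul_le_mul_left _ hts) hba, ?_⟩
    · simpa [hT, ternaryExtension, Nat.mul_add_div hN, Nat.mod_eq_of_lt haN,
        Nat.div_eq_of_lt haN] using ⟨ha, hs⟩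
    · simpa [hT, ternaryExtension, Nat.mul_add_div hN, Nat.mod_eq_of_lt hbN,
        Nat.div_eq_of_lt hbN] using ⟨hb, ht⟩
    · zify at hq ⊢
      linear_combination N * hq - hd
  obtain ⟨S, hS0, hSfree, hST⟩ := exists_stanleySet_eq hT0 hTfree hTcover
  refine ⟨S, hS0, hSfree, k, fun K hK => ?_⟩
  obtain ⟨j, rfl⟩ := Nat.exists_eq_add_of_le hK
  have hseq : ∀ n, stanleySeq S n = Nat.nth (· ∈ T) n := fun n => by rw [stanleySeq, hST]
  simp only [hseq]
  have hzero : Nat.nth (· ∈ T) 0 = 0 := Nat.nth_zero_of_zero hT0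
  have hadd : ∀ j i, i < 2 ^ (k + j) → Nat.nth (· ∈ T) (2 ^ (k + j) + i) =
      N * 3 ^ j + Nat.nth (· ∈ T) i := fun j i hi => nth_ternaryExtension_add hlt hcard hi
  have hstart : ∀ j, Nat.nth (· ∈ T) (2 ^ (k + j)) = N * 3 ^ j := fun j => by
    have := hadd j 0 (by positivity)
    rwa [Nat.add_zero, hzero, Nat.add_zero] at this
  have hend : ∀ j, N * 3 ^ j + lam = 2 * Nat.nth (· ∈ T) (2 ^ (k + j) - 1) + 1 := by
    intro j
    induction j with
    | zero =>
      have hMT : M ∈ T := (mem_ternaryExtension_of_lt hMN).2 hM.1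
      have hcount : Nat.count (· ∈ T) (M + 1) = 2 ^ k := by
        rw [Nat.count_eq_card_filter_range, ← hcard]
        congr 1
        ext x
        rw [Finset.mem_filter, Finset.mem_range]
        exact ⟨fun ⟨hx, hx'⟩ => (mem_ternaryExtension_of_lt (by omega)).1 hx',
          fun hx => ⟨Nat.lt_succ_of_le (hM.2 hx), (mem_ternaryExtension_of_lt (hlt x hx)).2 hx⟩⟩
      rw [Nat.count_succ, if_pos hMT] at hcount
      have hnth := Nat.nth_count hMT
      rw [show Nat.count (· ∈ T) M = 2 ^ (k + 0) - 1 by rw [Nat.add_zero]; omega] at hnth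
      rw [hnth, pow_zero]
      omega
    | succ j ih =>
      have hpos : 0 < 2 ^ (k + j) := by positivity
      rw [show 2 ^ (k + (j + 1)) - 1 = 2 ^ (k + j) + (2 ^ (k + j) - 1) by
        rw [← Nat.add_assoc, pow_succ]; omega, hadd j _ (by omega), pow_succ, ← mul_assoc]
      omega
  exact ⟨fun i hi => by rw [hstart]; exact hadd j i hi,
    by rw [hstart]; exact hend j⟩

/-- A near-modular set with `2 ^ k` elements yields an independent Stanley sequence. -/
theorem isCharacter {A : Finset ℕ} {N k M lam : ℕ} (h : NearModular (A : Set ℕ) N)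
    (hcard : A.card = 2 ^ k) (hM : IsGreatest (A : Set ℕ) M)
    (hlam : lam + N = 2 * M + 1) : IsCharacter lam := by
  have hN : 0 < N := h.pos fun a ha => hM.2 ha
  have hlift : ∀ j, ∃ B : Finset ℕ, ∃ M' : ℕ, NearModular (B : Set ℕ) (3 ^ j * N) ∧
      B.card = 2 ^ (k + j) ∧ IsGreatest (B : Set ℕ) M' ∧ lam + 3 ^ j * N = 2 * M' + 1 := by
    intro j
    induction j with
    | zero => exact ⟨A, M, by simpa using h, hcard, hM, by simpa using hlam⟩
    | succ j ih =>
      obtain ⟨B, M', hB, hBcard, hM', hl⟩ := ih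
      obtain ⟨h1, h2⟩ := hB.union_translate (by positivity)
      refine ⟨_, 3 ^ j * N + M', by rwa [pow_succ', mul_assoc], by rw [h2, hBcard]; ring,
        ⟨?_, ?_⟩, by rw [pow_succ', mul_assoc]; omega⟩
      · rw [Finset.mem_coe]
        exact Finset.mem_union_right _ (Finset.mem_image_of_mem _ hM'.1)
      · intro x hx
        rcases Finset.mem_union.1 (Finset.mem_coe.1 hx) with hx | hx
        · exact (hM'.2 hx).trans (Nat.le_add_left _ _)
        · obtain ⟨b, hb, rfl⟩ := Finset.mem_image.1 hx
          exact Nat.add_le_add_left (hM'.2 hb) _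
  obtain ⟨B, M', hB, hBcard, hM', hl⟩ := hlift lam
  have : lam < 3 ^ lam := Nat.lt_pow_self (by norm_num)
  have : 3 ^ lam ≤ 3 ^ lam * N := Nat.le_mul_of_pos_right _ hN
  exact hB.isCharacter_of_lt hBcard hM' (by omega) hl

/-- Moving elements within their residue classes without changing their order preserves
near-modularity. -/
theorem image {A : Set ℕ} {N : ℕ} (h : NearModular A N) {f : ℕ → ℕ} (h0 : f 0 = 0)
    (hf : StrictMonoOn f A) (hmod : ∀ a ∈ A, (f a : ℤ) ≡ a [ZMOD N]) :
    NearModular (f '' A) N := by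
  refine ⟨⟨0, h.1, h0⟩, ?_, fun x => ?_⟩
  · rintro _ ⟨x, hx, rfl⟩ _ ⟨y, hy, rfl⟩ _ ⟨z, hz, rfl⟩ hxyz
    obtain ⟨rfl, rfl⟩ := h.2.1 x hx y hy z hz ((hmod x hx).symm.trans
      (hxyz.trans (((hmod y hy).mul_left 2).sub (hmod z hz))))
    exact ⟨rfl, rfl⟩
  · obtain ⟨y, hy, z, hz, hzy, hx⟩ := h.2.2 x
    exact ⟨f y, ⟨y, hy, rfl⟩, f z, ⟨z, hz, rfl⟩, hf.monotoneOn hz hy hzy,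
      hx.trans (((hmod y hy).mul_left 2).sub (hmod z hz)).symm⟩

/-- The greatest element of a near-modular set may be raised by any multiple of the modulus. -/
theorem isCharacter_add_mul {A : Finset ℕ} {N k M : ℕ} (h : NearModular (A : Set ℕ) N)
    (hcard : A.card = 2 ^ k) (hM : IsGreatest (A : Set ℕ) M) (hM0 : 0 < M) {t lam : ℕ}
    (hlam : lam + N = 2 * (M + N * t) + 1) : IsCharacter lam := by
  let f : ℕ → ℕ := fun x => if x = M then M + N * t else x
  have hfM : f M = M + N * t := if_pos rfl
  have hf : StrictMonoOn f A := by
    intro x hx y hy hxy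
    have hyM := hM.2 hy
    simp only [f]
    rw [if_neg (by omega)]
    split_ifs <;> omega
  have himage : NearModular ((A.image f : Finset ℕ) : Set ℕ) N := by
    rw [Finset.coe_image]
    refine h.image (if_neg hM0.ne) hf fun a _ => ?_
    by_cases ha : a = M
    · rw [ha, hfM, Int.modEq_iff_dvd]
      exact ⟨-t, by push_cast; ring⟩
    · rw [show f a = a from if_neg ha]
  refine himage.isCharacter (k := k) (M := M + N * t) ?_ ⟨?_, ?_⟩ hlam
  · rw [Finset.card_image_of_injOn hf.injOn, hcard]
  · exact Finset.mem_coe.2 (Finset.mem_image.2 ⟨M, hM.1, hfM⟩)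
  · intro x hx
    obtain ⟨a, ha, rfl⟩ := Finset.mem_image.1 (Finset.mem_coe.1 hx)
    rw [← hfM]
    exact hf.monotoneOn ha hM.1 (hM.2 ha)

theorem of_forall_mod {A : Finset ℕ} {N : ℕ} (hN : 0 < N) (h0 : 0 ∈ A)
    (hfree : ∀ x ∈ A, ∀ y ∈ A, ∀ z ∈ A, (x + z) % N = 2 * y % N → x = y ∧ y = z)
    (hcover : ∀ r < N, ∃ y ∈ A, ∃ z ∈ A, z ≤ y ∧ (r + z) % N = 2 * y % N) :
    NearModular (A : Set ℕ) N := by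
  refine ⟨h0, fun x hx y hy z hz h => hfree x hx y hy z hz ?_, fun x => ?_⟩
  · have h' := h.add_right (z : ℤ)
    rw [sub_add_cancel] at h'
    exact Int.natCast_modEq_iff.1 (by exact_mod_cast h')
  · have hNz : (0 : ℤ) < N := by exact_mod_cast hN
    have hr := Int.toNat_of_nonneg (Int.emod_nonneg x hNz.ne')
    have hrN := Int.emod_lt_of_pos x hNz
    obtain ⟨y, hy, z, hz, hzy, h⟩ := hcover (x % N).toNat (by omega)
    refine ⟨y, hy, z, hz, hzy, ?_⟩
    have h' : (((x % N).toNat + z : ℕ) : ℤ) ≡ ((2 * y : ℕ) : ℤ) [ZMOD N] :=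
      Int.natCast_modEq_iff.2 h
    push_cast [hr] at h'
    have h'' := h'.sub_right (z : ℤ)
    rw [add_sub_cancel_right] at h''
    exact (Int.mod_modEq x N).symm.trans h''

end NearModular

/-- A finite check on `A` that produces a whole residue class of characters. -/
theorem isCharacter_of_check (A : Finset ℕ) (N k M : ℕ) (hN : 0 < N ∧ 0 < M ∧ 0 ∈ A ∧ M ∈ A)
    (hcard : A.card = 2 ^ k) (hM : ∀ a ∈ A, a ≤ M)
    (hfree : ∀ x ∈ A, ∀ y ∈ A, ∀ z ∈ A, (x + z) % N = 2 * y % N → x = y ∧ y = z)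
    (hcover : ∀ r < N, ∃ y ∈ A, ∃ z ∈ A, z ≤ y ∧ (r + z) % N = 2 * y % N)
    {lam : ℕ} (t : ℕ) (hlam : lam + N = 2 * (M + N * t) + 1) : IsCharacter lam :=
  (NearModular.of_forall_mod hN.1 hN.2.2.1 hfree hcover).isCharacter_add_mul hcard
    ⟨hN.2.2.2, fun _ ha => hM _ ha⟩ hN.2.1 hlam

theorem isCharacter_of_mod_6 {lam : ℕ} (h : lam % 6 = 0 ∨ lam % 6 = 2) :
    IsCharacter lam := by
  rcases h with h | h
  · exact isCharacter_of_check {0, 1} 3 1 1 (by decide +kernel)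
      (by decide +kernel) (by decide +kernel) (by decide +kernel) (by decide +kernel)
      (lam / 6) (by omega)
  · exact isCharacter_of_check {0, 2} 3 1 2 (by decide +kernel)
      (by decide +kernel) (by decide +kernel) (by decide +kernel) (by decide +kernel)
      (lam / 6) (by omega)

theorem isCharacter_of_mod_18 {lam : ℕ} (h : lam % 18 = 4 ∨ lam % 18 = 16) :
    IsCharacter lam := by
  rcases h with h | h
  · exact isCharacter_of_check {0, 2, 5, 6} 9 2 6 (by decide +kernel)
      (by decide +kernel) (by decide +kernel) (by decide +kernel) (by decide +kernel)
      (lam / 18) (by omega)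
  · exact isCharacter_of_check {0, 1, 4, 12} 9 2 12 (by decide +kernel)
      (by decide +kernel) (by decide +kernel) (by decide +kernel) (by decide +kernel)
      (lam / 18) (by omega)

theorem isCharacter_of_mod_54 {lam : ℕ} (h : lam % 54 = 10 ∨ lam % 54 = 46) :
    IsCharacter lam := by
  rcases h with h | h
  · exact isCharacter_of_check {0, 1, 4, 6, 10, 13, 15, 18} 27 3 18 (by decide +kernel)
      (by decide +kernel) (by decide +kernel) (by decide +kernel) (by decide +kernel)
      (lam / 54) (by omega)
  · exact isCharacter_of_check {0, 1, 3, 4, 10, 13, 21, 36} 27 3 36 (by decide +kernel)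
      (by decide +kernel) (by decide +kernel) (by decide +kernel) (by decide +kernel)
      (lam / 54) (by omega)

theorem isCharacter_of_mod_162 {lam : ℕ} (h : lam % 162 = 28 ∨ lam % 162 = 136) :
    IsCharacter lam := by
  rcases h with h | h
  · exact isCharacter_of_check
      {0, 1, 3, 4, 10, 13, 18, 21, 28, 30, 31, 37, 40, 45, 48, 54}
      81 4 54 (by decide +kernel)
      (by decide +kernel) (by decide +kernel) (by decide +kernel) (by decide +kernel)
      (lam / 162) (by omega)
  · exact isCharacter_of_check
      {0, 1, 3, 4, 9, 10, 12, 13, 28, 36, 37, 57, 58, 66, 67, 108}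
      81 4 108 (by decide +kernel)
      (by decide +kernel) (by decide +kernel) (by decide +kernel) (by decide +kernel)
      (lam / 162) (by omega)

set_option maxHeartbeats 2000000 in
theorem isCharacter_of_mod_486 {lam : ℕ} (h : lam % 486 = 82 ∨ lam % 486 = 406) :
    IsCharacter lam := by
  rcases h with h | h
  · exact isCharacter_of_check
      {0, 8, 9, 26, 32, 33, 36, 50, 51, 54, 59, 60, 62, 77, 78, 80, 89, 90, 107, 113, 114, 117,
      131, 132, 135, 140, 141, 143, 158, 159, 161, 162}
      243 5 162 (by decide +kernel)
      (by decide +kernel) (by decide +kernel) (by decide +kernel) (by decide +kernel)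
      (lam / 486) (by omega)
  · exact isCharacter_of_check
      {0, 1, 3, 4, 9, 10, 12, 13, 27, 28, 30, 31, 36, 37, 39, 40, 82, 90, 91, 93, 94, 109, 117,
      118, 120, 121, 165, 166, 189, 192, 193, 324}
      243 5 324 (by decide +kernel)
      (by decide +kernel) (by decide +kernel) (by decide +kernel) (by decide +kernel)
      (lam / 486) (by omega)

/-- Every nonnegative integer `lam` with `lam ≡ 0 (mod 2)` and
`lam ≢ 244 (mod 486)` is the character of an independent Stanley sequence. -/
theorem even_not_244_mod_486_isCharacter (lam : ℕ)
    (h2 : lam % 2 = 0) (h486 : lam % 486 ≠ 244) :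
    IsCharacter lam := by
  have hcases : (lam % 6 = 0 ∨ lam % 6 = 2) ∨ (lam % 18 = 4 ∨ lam % 18 = 16) ∨
      (lam % 54 = 10 ∨ lam % 54 = 46) ∨ (lam % 162 = 28 ∨ lam % 162 = 136) ∨
      (lam % 486 = 82 ∨ lam % 486 = 406) := by omega
  rcases hcases with h | h | h | h | h
  · exact isCharacter_of_mod_6 h
  · exact isCharacter_of_mod_18 h
  · exact isCharacter_of_mod_54 h
  · exact isCharacter_of_mod_162 h
  · exact isCharacter_of_mod_486 h
end

section
/- Suppose A is a near-modular set with respect to 3^ℓ for some ℓ ≥ 1 with |A| = 2^ℓ, and (b_k)_{k≥0} is a sequence of positive integers such that 3^{k+ℓ} is the largest power of three dividing b_k for every k, and b_k = 3^{k+ℓ} for all sufficiently large k. Then the set { a + Σ_{k≥0} δ_k·b_k : a ∈ A, δ_k ∈ {0,1}, only finitely many δ_k nonzero } is the set of terms of an independent Stanley sequence. -/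
/-- The sums `a + Σ_{j ∈ F} b j` with `a ∈ A` and `F ⊆ {0, …, k - 1}`. -/
def partialSums (A : Finset ℕ) (b : ℕ → ℕ) : ℕ → Finset ℕ
  | 0 => A
  | k + 1 => partialSums A b k ∪ (partialSums A b k).image (· + b k)

theorem mem_partialSums_succ {A : Finset ℕ} {b : ℕ → ℕ} {k x : ℕ} :
    x ∈ partialSums A b (k + 1) ↔
      x ∈ partialSums A b k ∨ ∃ a ∈ partialSums A b k, a + b k = x := by
  simp [partialSums]

theorem mem_partialSums_succ_iff_digit {A : Finset ℕ} {b : ℕ → ℕ} {k x : ℕ} :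
    x ∈ partialSums A b (k + 1) ↔
      ∃ a ∈ partialSums A b k, ∃ d : ℕ, d ≤ 1 ∧ x = a + d * b k := by
  rw [mem_partialSums_succ]
  constructor
  · rintro (h | ⟨a, ha, rfl⟩)
    · exact ⟨x, h, 0, by omega, by simp⟩
    · exact ⟨a, ha, 1, le_rfl, by simp⟩
  · rintro ⟨a, ha, d, hd, rfl⟩
    interval_cases d
    · left; simpa using ha
    · right; exact ⟨a, ha, by simp⟩

theorem partialSums_mono (A : Finset ℕ) (b : ℕ → ℕ) : Monotone (partialSums A b) :=
  monotone_nat_of_le_succ fun _ => Finset.subset_union_left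

theorem mem_partialSums_iff {A : Finset ℕ} {b : ℕ → ℕ} {k x : ℕ} :
    x ∈ partialSums A b k ↔ ∃ a ∈ A, ∃ F ⊆ Finset.range k, x = a + ∑ j ∈ F, b j := by
  induction k generalizing x with
  | zero => simp [partialSums]
  | succ k ih =>
    rw [mem_partialSums_succ]
    constructor
    · rintro (h | ⟨y, hy, rfl⟩)
      · obtain ⟨a, ha, F, hF, rfl⟩ := ih.1 h
        exact ⟨a, ha, F, hF.trans (Finset.range_subset_range.2 (Nat.le_succ k)), rfl⟩
      · obtain ⟨a, ha, F, hF, rfl⟩ := ih.1 hy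
        have hk : k ∉ F := fun h => by simpa using hF h
        refine ⟨a, ha, insert k F, ?_, ?_⟩
        · rw [Finset.range_add_one]
          exact Finset.insert_subset_insert k hF
        · rw [Finset.sum_insert hk]; ring
    · rintro ⟨a, ha, F, hF, rfl⟩
      by_cases hk : k ∈ F
      · refine Or.inr ⟨a + ∑ j ∈ F.erase k, b j, ih.2 ⟨a, ha, F.erase k, ?_, rfl⟩, ?_⟩
        · rw [Finset.range_add_one] at hF
          simpa [Finset.subset_insert_iff] using hF
        · rw [← Finset.sum_erase_add F b hk]; ring
      · refine Or.inl (ih.2 ⟨a, ha, F, ?_, rfl⟩)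
        rw [Finset.range_add_one] at hF
        exact (Finset.subset_insert_iff_of_notMem hk).1 hF

theorem setOf_add_sum_eq_iUnion_partialSums (A : Finset ℕ) (b : ℕ → ℕ) :
    {x : ℕ | ∃ a ∈ A, ∃ F : Finset ℕ, x = a + ∑ k ∈ F, b k} =
      ⋃ k, (partialSums A b k : Set ℕ) := by
  ext x
  simp only [Set.mem_ofPred_eq, Set.mem_iUnion, Finset.mem_coe]
  constructor
  · rintro ⟨a, ha, F, rfl⟩
    obtain ⟨k, hk⟩ := F.exists_nat_subset_range
    exact ⟨k, mem_partialSums_iff.2 ⟨a, ha, F, hk, rfl⟩⟩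
  · rintro ⟨k, hk⟩
    obtain ⟨a, ha, F, -, h⟩ := mem_partialSums_iff.1 hk
    exact ⟨a, ha, F, h⟩

theorem NearModular.eq_of_modEq {A : Set ℕ} {N : ℕ} (h : NearModular A N) {x y : ℕ}
    (hx : x ∈ A) (hy : y ∈ A) (hxy : (x : ℤ) ≡ y [ZMOD N]) : x = y := by
  refine (h.2.1 x hx y hy y hy ?_).1
  convert hxy using 1
  ring

theorem NearModular.threeAPFree {A : Set ℕ} {N : ℕ} (h : NearModular A N) :
    ThreeAPFree A := by
  intro x hx y hy z hz hxyz
  refine (h.2.1 x hx y hy z hz ?_).1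
  have : (x : ℤ) = 2 * y - z := by
    have : (x : ℤ) + z = y + y := by exact_mod_cast hxyz
    linarith
  rw [this]

theorem NearModular.partialSums_succ {A : Finset ℕ} {b : ℕ → ℕ} {k N : ℕ} (hN : 0 < N)
    (h : NearModular (partialSums A b k : Set ℕ) N) (h1 : N ∣ b k) (h2 : ¬ 3 * N ∣ b k) :
    NearModular (partialSums A b (k + 1) : Set ℕ) (3 * N) := by
  obtain ⟨c, hc⟩ := h1
  have hc3 : ¬ 3 ∣ c := by
    rintro ⟨m, rfl⟩
    exact h2 ⟨m, by rw [hc]; ring⟩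
  have hN' : (N : ℤ) ≠ 0 := by exact_mod_cast hN.ne'
  obtain ⟨h0, hap, hcov⟩ := h
  refine ⟨?_, ?_, ?_⟩
  · exact mem_partialSums_succ.2 (Or.inl h0)
  · intro x hx y hy z hz hxyz
    obtain ⟨x', hx', d, hd, rfl⟩ := mem_partialSums_succ_iff_digit.1 hx
    obtain ⟨y', hy', e, he, rfl⟩ := mem_partialSums_succ_iff_digit.1 hy
    obtain ⟨z', hz', f, hf, rfl⟩ := mem_partialSums_succ_iff_digit.1 hz
    rw [hc] at hxyz ⊢
    push_cast at hxyz
    obtain ⟨m, hm⟩ := hxyz.dvd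
    have key : (x' : ℤ) ≡ 2 * (y' : ℤ) - (z' : ℤ) [ZMOD (N : ℤ)] :=
      (Int.modEq_iff_dvd).2 ⟨3 * m - c * (2 * e - f - d), by linear_combination hm⟩
    obtain ⟨rfl, rfl⟩ := hap x' hx' y' hy' z' hz' key
    have h3 : (c : ℤ) * (2 * e - f - d) = 3 * m := by
      apply mul_left_cancel₀ hN'
      linear_combination hm
    have h4 : (3 : ℤ) ∣ 2 * e - f - d := by
      refine (Int.prime_three.dvd_or_dvd ⟨m, h3⟩).resolve_left fun h => hc3 ?_
      exact_mod_cast h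
    obtain ⟨rfl, rfl⟩ : d = e ∧ e = f := by
      clear * - h4 hd he hf
      interval_cases d <;> interval_cases e <;> interval_cases f <;> omega
    exact ⟨rfl, rfl⟩
  · intro x
    obtain ⟨y, hy, z, hz, hzy, hxyz⟩ := hcov x
    obtain ⟨t, ht⟩ := hxyz.symm.dvd
    obtain ⟨e, f, he, hfe, m, hm⟩ :
        ∃ e f : ℕ, e ≤ 1 ∧ f ≤ e ∧ (3 : ℤ) ∣ c * (2 * e - f) - t := by
      have hc12 : c % 3 = 1 ∨ c % 3 = 2 := by omega
      by_cases ht0 : t % 3 = 0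
      · exact ⟨0, 0, by omega, by omega, by push_cast; omega⟩
      by_cases htc : t % 3 = c % 3
      · exact ⟨1, 1, by omega, by omega, by push_cast; omega⟩
      · exact ⟨1, 0, by omega, by omega, by rcases hc12 with h | h <;> push_cast <;> omega⟩
    refine ⟨y + e * b k, mem_partialSums_succ_iff_digit.2 ⟨y, hy, e, he, rfl⟩,
      z + f * b k, mem_partialSums_succ_iff_digit.2 ⟨z, hz, f, by omega, rfl⟩,
      add_le_add hzy (Nat.mul_le_mul_right _ hfe), (Int.modEq_iff_dvd).2 ⟨m, ?_⟩⟩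
    rw [hc]
    push_cast
    linear_combination N * hm - ht

theorem card_partialSums_succ {A : Finset ℕ} {b : ℕ → ℕ} {k N : ℕ} (hb : 0 < b k)
    (h : NearModular (partialSums A b k : Set ℕ) N) (h1 : N ∣ b k) :
    (partialSums A b (k + 1)).card = 2 * (partialSums A b k).card := by
  rw [partialSums, Finset.card_union_of_disjoint,
    Finset.card_image_of_injective _ (add_left_injective _), two_mul]
  rw [Finset.disjoint_left]
  intro x hx hx'
  obtain ⟨a, ha, rfl⟩ := Finset.mem_image.1 hx'
  have := h.eq_of_modEq hx ha (by
    push_cast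
    refine ((Int.modEq_iff_dvd).2 ?_)
    have : (N : ℤ) ∣ b k := by exact_mod_cast h1
    simpa using this)
  omega

/-- If `B` contains no three-term progression and every integer beyond `p ∈ B` that is not in `B`
ends a progression started in `B`, then `B` is the Stanley sequence of its terms up to `p`. -/
theorem stanleySet_eq_of_covers {B : Set ℕ} [DecidablePred (· ∈ B)] (hB : ThreeAPFree B)
    (hinf : B.Infinite) {p : ℕ} (hp : p ∈ B)
    (hcov : ∀ x, p < x → x ∉ B → ∃ y ∈ B, ∃ z ∈ B, z < y ∧ x + z = 2 * y) :
    stanleySet ((Finset.range (p + 1)).filter (· ∈ B)) = B := by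
  have hstep : ∀ q ∈ B, p ≤ q → ∃ r ∈ B, q < r ∧
      insert (stanleyNext ((Finset.range (q + 1)).filter (· ∈ B)))
        ((Finset.range (q + 1)).filter (· ∈ B)) = (Finset.range (r + 1)).filter (· ∈ B) := by
    intro q hq hpq
    have hex : ∃ r, r ∈ B ∧ q < r := hinf.exists_gt q
    obtain ⟨hr, hqr⟩ := Nat.find_spec hex
    have hmin : ∀ x ∈ B, x < Nat.find hex → x ≤ q := fun x hx hlt =>
      not_lt.1 fun hqx => Nat.find_min hex hlt ⟨hx, hqx⟩
    generalize Nat.find hex = r at hr hqr hmin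
    refine ⟨r, hr, hqr, ?_⟩
    have hnext : stanleyNext ((Finset.range (q + 1)).filter (· ∈ B)) = r := by
      refine IsLeast.csInf_eq ⟨⟨?_, ?_⟩, ?_⟩
      · intro s hs
        simp only [Finset.mem_filter, Finset.mem_range] at hs
        omega
      · refine hB.mono (Set.insert_subset hr ?_)
        intro s hs
        exact (Finset.mem_filter.1 hs).2
      · rintro x ⟨hx, hfree⟩
        by_contra! hxr
        have hqx : q < x := hx q (by simp [hq])
        have hxB : x ∉ B := fun h => by have := hmin x h hxr; omega
        obtain ⟨y, hy, z, hz, hzy, hxyz⟩ := hcov x (by omega) hxB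
        have hmem : ∀ w ∈ B, w < r →
            w ∈ insert x (((Finset.range (q + 1)).filter (· ∈ B) : Finset ℕ) : Set ℕ) := by
          intro w hw hwr
          have := hmin w hw hwr
          right
          simp only [Finset.coe_filter, Finset.mem_range, Set.mem_ofPred_eq]
          exact ⟨by omega, hw⟩
        have := hfree (hmem z hz (by omega)) (hmem y hy (by omega)) (Set.mem_insert x _) (by omega)
        omega
    rw [hnext]
    ext x
    simp only [Finset.mem_insert, Finset.mem_filter, Finset.mem_range]
    constructor
    · rintro (rfl | ⟨h1, h2⟩)
      · exact ⟨by omega, hr⟩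
      · exact ⟨by omega, h2⟩
    · rintro ⟨h1, h2⟩
      by_cases hxr : x = r
      · exact Or.inl hxr
      · have := hmin x h2 (by omega)
        exact Or.inr ⟨by omega, h2⟩
  have hiter : ∀ n, ∃ q ∈ B, p + n ≤ q ∧
      stanleyIter ((Finset.range (p + 1)).filter (· ∈ B)) n =
        (Finset.range (q + 1)).filter (· ∈ B) := by
    intro n
    induction n with
    | zero => exact ⟨p, hp, le_rfl, rfl⟩
    | succ n ih =>
      obtain ⟨q, hq, hpq, hS⟩ := ih
      obtain ⟨r, hr, hqr, hS'⟩ := hstep q hq (by omega)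
      exact ⟨r, hr, by omega, by rw [stanleyIter, hS, hS']⟩
  ext x
  simp only [stanleySet, Set.mem_iUnion, Finset.mem_coe]
  constructor
  · rintro ⟨n, hn⟩
    obtain ⟨q, -, -, hS⟩ := hiter n
    rw [hS] at hn
    exact (Finset.mem_filter.1 hn).2
  · intro hx
    obtain ⟨q, -, hq, hS⟩ := hiter x
    exact ⟨x, by rw [hS]; simp only [Finset.mem_filter, Finset.mem_range]; exact ⟨by omega, hx⟩⟩

theorem nearModular_partialSums {ℓ : ℕ} {A : Finset ℕ} {b : ℕ → ℕ}
    (hA : NearModular (A : Set ℕ) (3 ^ ℓ))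
    (hdvd : ∀ k, 3 ^ (k + ℓ) ∣ b k ∧ ¬ 3 ^ (k + ℓ + 1) ∣ b k) (k : ℕ) :
    NearModular (partialSums A b k : Set ℕ) (3 ^ (k + ℓ)) := by
  induction k with
  | zero => simpa [partialSums] using hA
  | succ k ih =>
    have h : 3 ^ (k + 1 + ℓ) = 3 * 3 ^ (k + ℓ) := by ring
    have h' : 3 ^ (k + ℓ + 1) = 3 * 3 ^ (k + ℓ) := by ring
    rw [h]
    exact ih.partialSums_succ (by positivity) (hdvd k).1 (h' ▸ (hdvd k).2)

theorem card_partialSums {ℓ : ℕ} {A : Finset ℕ} {b : ℕ → ℕ}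
    (hA : NearModular (A : Set ℕ) (3 ^ ℓ)) (hcard : A.card = 2 ^ ℓ) (hpos : ∀ k, 0 < b k)
    (hdvd : ∀ k, 3 ^ (k + ℓ) ∣ b k ∧ ¬ 3 ^ (k + ℓ + 1) ∣ b k) (k : ℕ) :
    (partialSums A b k).card = 2 ^ (k + ℓ) := by
  induction k with
  | zero => simpa [partialSums] using hcard
  | succ k ih =>
    rw [card_partialSums_succ (hpos k) (nearModular_partialSums hA hdvd k) (hdvd k).1, ih]
    ring

theorem exists_forall_mem_partialSums_lt {ℓ : ℕ} {A : Finset ℕ} {b : ℕ → ℕ} {K : ℕ}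
    (hK : ∀ k ≥ K, b k = 3 ^ (k + ℓ)) :
    ∃ L ≥ K, ∀ k ≥ L, ∀ x ∈ partialSums A b k, x < 3 ^ (k + ℓ) := by
  obtain ⟨C, hC⟩ := (partialSums A b K).exists_nat_subset_range
  have hbound : ∀ k ≥ K, ∀ x ∈ partialSums A b k, 2 * x ≤ 2 * C + 3 ^ (k + ℓ) := by
    intro k hk
    induction k, hk using Nat.le_induction with
    | base =>
      intro x hx
      have := Finset.mem_range.1 (hC hx)
      have : 0 < 3 ^ (K + ℓ) := by positivity
      omega
    | succ k hk ih =>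
      intro x hx
      have h : 3 ^ (k + 1 + ℓ) = 3 * 3 ^ (k + ℓ) := by ring
      rcases mem_partialSums_succ.1 hx with hx | ⟨a, ha, rfl⟩
      · have := ih x hx
        omega
      · have := ih a ha
        rw [hK k hk]
        omega
  refine ⟨K + 2 * C, by omega, fun k hk x hx => ?_⟩
  have h1 := hbound k (by omega) x hx
  have h2 : k + ℓ < 3 ^ (k + ℓ) := Nat.lt_pow_self (by norm_num)
  omega

theorem partialSums_of_lt {A : Finset ℕ} {b : ℕ → ℕ} {ℓ K : ℕ}
    (hK : ∀ k ≥ K, b k = 3 ^ (k + ℓ)) {j k x : ℕ} (hk : K ≤ k)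
    (hx : x ∈ partialSums A b j) (hlt : x < 3 ^ (k + ℓ)) : x ∈ partialSums A b k := by
  induction j with
  | zero => exact partialSums_mono A b (Nat.zero_le k) hx
  | succ j ih =>
    rcases le_total (j + 1) k with hjk | hjk
    · exact partialSums_mono A b hjk hx
    rcases Nat.lt_or_ge j k with hj | hj
    · exact partialSums_mono A b hj hx
    rcases mem_partialSums_succ.1 hx with hx | ⟨a, ha, rfl⟩
    · exact ih hx
    · rw [hK j (by omega)] at hlt
      have : 3 ^ (k + ℓ) ≤ 3 ^ (j + ℓ) := Nat.pow_le_pow_right (by norm_num) (by omega)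
      omega

theorem exists_partialSums_add_eq_two_mul {A : Finset ℕ} {b : ℕ → ℕ} {ℓ K : ℕ}
    (hK : ∀ k ≥ K, b k = 3 ^ (k + ℓ)) {y z : ℕ} (hy : y ∈ partialSums A b K)
    (hz : z ∈ partialSums A b K) (hzy : z ≤ y) (j t : ℕ) (ht : t < 3 ^ j) :
    ∃ u ∈ partialSums A b (K + j), ∃ v ∈ partialSums A b (K + j), v ≤ u ∧
      2 * y + t * 3 ^ (K + ℓ) + v = 2 * u + z := by
  induction j generalizing t with
  | zero =>
    obtain rfl : t = 0 := by simpa using ht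
    exact ⟨y, hy, z, hz, hzy, by ring⟩
  | succ j ih =>
    obtain ⟨u, hu, v, hv, hvu, h⟩ := ih (t % 3 ^ j) (Nat.mod_lt _ (by positivity))
    have hd : t / 3 ^ j < 3 := Nat.div_lt_of_lt_mul (by rwa [← pow_succ])
    have hdiv := Nat.mod_add_div t (3 ^ j)
    have hb : b (K + j) = 3 ^ j * 3 ^ (K + ℓ) := by
      rw [hK _ (Nat.le_add_right K j)]; ring
    obtain ⟨e, f, he, hfe, hef⟩ : ∃ e f : ℕ, e ≤ 1 ∧ f ≤ e ∧ t / 3 ^ j + f = 2 * e := by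
      generalize t / 3 ^ j = d at hd
      interval_cases d
      exacts [⟨0, 0, by omega⟩, ⟨1, 1, by omega⟩, ⟨1, 0, by omega⟩]
    refine ⟨u + e * b (K + j), mem_partialSums_succ_iff_digit.2 ⟨u, hu, e, he, rfl⟩,
      v + f * b (K + j), mem_partialSums_succ_iff_digit.2 ⟨v, hv, f, by omega, rfl⟩,
      add_le_add hvu (Nat.mul_le_mul_right _ hfe), ?_⟩
    rw [hb]
    nth_rewrite 1 [← hdiv]
    zify at h hef ⊢
    linear_combination h + 3 ^ j * 3 ^ (K + ℓ) * hef

theorem iUnion_partialSums_covers {A : Finset ℕ} {b : ℕ → ℕ} {ℓ K : ℕ}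
    (hK : ∀ k ≥ K, b k = 3 ^ (k + ℓ))
    (hmod : NearModular (partialSums A b K : Set ℕ) (3 ^ (K + ℓ)))
    (hlt : ∀ x ∈ partialSums A b K, x < 3 ^ (K + ℓ)) {x : ℕ} (hx : 3 ^ (K + ℓ) ≤ x)
    (hxB : x ∉ ⋃ k, (partialSums A b k : Set ℕ)) :
    ∃ y ∈ ⋃ k, (partialSums A b k : Set ℕ), ∃ z ∈ ⋃ k, (partialSums A b k : Set ℕ),
      z < y ∧ x + z = 2 * y := by
  obtain ⟨y, hy, z, hz, hzy, hxyz⟩ := hmod.2.2 x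
  obtain ⟨t, ht⟩ := hxyz.symm.dvd
  have hylt := hlt y hy
  have hNpos : (0 : ℤ) < 3 ^ (K + ℓ) := by positivity
  have ht0 : 0 ≤ t := by
    by_contra! hneg
    push_cast at ht
    zify at hx hylt
    nlinarith
  lift t to ℕ using ht0
  have ht' : x + z = 2 * y + t * 3 ^ (K + ℓ) := by
    zify
    push_cast at ht
    linear_combination ht
  obtain ⟨u, hu, v, hv, hvu, huv⟩ := exists_partialSums_add_eq_two_mul hK hy hz hzy t t
    (Nat.lt_pow_self (by norm_num))
  have hxv : x + v = 2 * u := by omega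
  refine ⟨u, Set.mem_iUnion.2 ⟨_, hu⟩, v, Set.mem_iUnion.2 ⟨_, hv⟩, ?_, hxv⟩
  refine lt_of_le_of_ne hvu fun h => hxB (Set.mem_iUnion.2 ⟨K + t, ?_⟩)
  obtain rfl : x = u := by omega
  exact hu

theorem threeAPFree_iUnion_of_monotone {S : ℕ → Set ℕ} (hS : Monotone S)
    (h : ∀ k, ThreeAPFree (S k)) : ThreeAPFree (⋃ k, S k) := by
  intro x hx y hy z hz hxyz
  obtain ⟨i, hi⟩ := Set.mem_iUnion.1 hx
  obtain ⟨j, hj⟩ := Set.mem_iUnion.1 hy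
  obtain ⟨k, hk⟩ := Set.mem_iUnion.1 hz
  exact h (i + j + k) (hS (by omega) hi) (hS (by omega) hj) (hS (by omega) hk) hxyz

theorem mem_iUnion_partialSums_iff_of_lt {A : Finset ℕ} {b : ℕ → ℕ} {ℓ K : ℕ}
    (hK : ∀ k ≥ K, b k = 3 ^ (k + ℓ)) {k x : ℕ} (hk : K ≤ k) (hx : x < 3 ^ (k + ℓ)) :
    x ∈ ⋃ k, (partialSums A b k : Set ℕ) ↔ x ∈ partialSums A b k := by
  rw [Set.mem_iUnion]
  exact ⟨fun ⟨_, hj⟩ => partialSums_of_lt hK hk hj hx, fun h => ⟨k, h⟩⟩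

theorem add_mem_iUnion_partialSums_iff {A : Finset ℕ} {b : ℕ → ℕ} {ℓ K : ℕ}
    (hK : ∀ k ≥ K, b k = 3 ^ (k + ℓ))
    (hlt : ∀ k ≥ K, ∀ x ∈ partialSums A b k, x < 3 ^ (k + ℓ)) {k x : ℕ} (hk : K ≤ k)
    (hx : x < 3 ^ (k + ℓ)) :
    3 ^ (k + ℓ) + x ∈ ⋃ k, (partialSums A b k : Set ℕ) ↔
      x ∈ ⋃ k, (partialSums A b k : Set ℕ) := by
  have h3 : 3 ^ (k + 1 + ℓ) = 3 * 3 ^ (k + ℓ) := by ring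
  rw [mem_iUnion_partialSums_iff_of_lt hK hk hx,
    mem_iUnion_partialSums_iff_of_lt hK (Nat.le_succ_of_le hk) (by rw [h3]; omega),
    mem_partialSums_succ, hK k hk]
  constructor
  · rintro (h | ⟨a, ha, h⟩)
    · have := hlt k hk _ h
      omega
    · obtain rfl : a = x := by omega
      exact ha
  · exact fun h => Or.inr ⟨x, h, add_comm _ _⟩

/-- The increasing enumeration of a set that is repeated with period `N` on `[N, 2N)`. -/
theorem nth_count_add {p : ℕ → Prop} [DecidablePred p] (hp : {x | p x}.Infinite) {N i : ℕ}
    (h : ∀ x < N, p (N + x) ↔ p x) (hi : i < Nat.count p N) :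
    Nat.nth p (Nat.count p N + i) = N + Nat.nth p i := by
  have hlt : Nat.nth p i < N := Nat.nth_lt_of_lt_count hi
  have hmem : p (N + Nat.nth p i) := (h _ hlt).2 (Nat.nth_mem_of_infinite hp i)
  have hcount : Nat.count p (N + Nat.nth p i) = Nat.count p N + i := by
    rw [Nat.count_add]
    congr 1
    have hcongr : Nat.count (fun x => p (N + x)) (Nat.nth p i) = Nat.count p (Nat.nth p i) := by
      simp only [Nat.count_eq_card_filter_range]
      congr 1
      exact Finset.filter_congr fun x hx => h x ((Finset.mem_range.1 hx).trans hlt)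
    rw [hcongr, Nat.count_nth_of_infinite hp i]
  rw [← hcount, Nat.nth_count hmem]

/-- If `A` is near-modular with respect to `3^ℓ` (`ℓ ≥ 1`) with `|A| = 2^ℓ`
and `(b k)` is a sequence of positive integers with `3^(k+ℓ)` the exact power of `3`
dividing `b k` and `b k = 3^(k+ℓ)` for large `k`, then
`{a + Σ_{k ∈ F} b k : a ∈ A, F finite}` is the set of terms of an independent Stanley
sequence. -/
theorem nearModular_basis_independent (ℓ : ℕ) (hℓ : 1 ≤ ℓ) (A : Finset ℕ)
    (hA : NearModular (A : Set ℕ) (3 ^ ℓ)) (hcard : A.card = 2 ^ ℓ)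
    (b : ℕ → ℕ) (hpos : ∀ k, 0 < b k)
    (hdvd : ∀ k, 3 ^ (k + ℓ) ∣ b k ∧ ¬ 3 ^ (k + ℓ + 1) ∣ b k)
    (hev : ∃ K, ∀ k ≥ K, b k = 3 ^ (k + ℓ)) :
    ∃ A' : Finset ℕ, 0 ∈ A' ∧ ThreeAPFree (A' : Set ℕ) ∧
      (∃ lam : ℕ, IsIndependent (stanleySeq A') lam) ∧
      stanleySet A' = {x : ℕ | ∃ a ∈ A, ∃ F : Finset ℕ, x = a + ∑ k ∈ F, b k} := by
  classical
  rw [setOf_add_sum_eq_iUnion_partialSums]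
  obtain ⟨K₀, hK₀⟩ := hev
  obtain ⟨K, hK₀K, hlt⟩ := exists_forall_mem_partialSums_lt (A := A) hK₀
  have hK : ∀ k ≥ K, b k = 3 ^ (k + ℓ) := fun k hk => hK₀ k (hK₀K.le.trans hk)
  have hmod := nearModular_partialSums hA hdvd
  have hsmall := fun {k x : ℕ} => mem_iUnion_partialSums_iff_of_lt (A := A) hK (k := k) (x := x)
  have hshift := fun {k x : ℕ} => add_mem_iUnion_partialSums_iff hK hlt (k := k) (x := x)
  have hcovers := fun {x : ℕ} => iUnion_partialSums_covers hK (hmod K) (hlt K le_rfl) (x := x)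
  have hfree : ThreeAPFree (⋃ k, (partialSums A b k : Set ℕ)) :=
    threeAPFree_iUnion_of_monotone (fun _ _ h => Finset.coe_subset.2 (partialSums_mono A b h))
      fun k => (hmod k).threeAPFree
  have hsub : ∀ k, (partialSums A b k : Set ℕ) ⊆ ⋃ k, (partialSums A b k : Set ℕ) :=
    fun k => Set.subset_iUnion (fun k => (partialSums A b k : Set ℕ)) k
  generalize (⋃ k, (partialSums A b k : Set ℕ)) = B at hsmall hshift hcovers hfree hsub ⊢
  have h0 : 0 ∈ B := hsub 0 hA.1
  have hpow : ∀ k ≥ K, 3 ^ (k + ℓ) ∈ B := fun k hk => by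
    simpa using (hshift hk (x := 0) (by positivity)).2 h0
  have hinf : B.Infinite := by
    refine Set.infinite_of_forall_exists_gt fun n => ⟨3 ^ (K + n + ℓ), hpow _ (by omega), ?_⟩
    have : K + n + ℓ < 3 ^ (K + n + ℓ) := Nat.lt_pow_self (by norm_num)
    omega
  have hset := stanleySet_eq_of_covers hfree hinf (hpow K le_rfl) fun x hx => hcovers hx.le
  have hcount : ∀ k ≥ K, Nat.count (· ∈ B) (3 ^ (k + ℓ)) = 2 ^ (k + ℓ) := by
    intro k hk
    rw [Nat.count_eq_card_filter_range, ← card_partialSums hA hcard hpos hdvd k]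
    congr 1
    ext x
    simp only [Finset.mem_filter, Finset.mem_range]
    exact ⟨fun h => (hsmall hk h.1).1 h.2, fun h => ⟨hlt k hk x h, hsub k h⟩⟩
  have hnth_add : ∀ k ≥ K, ∀ i < 2 ^ (k + ℓ),
      Nat.nth (· ∈ B) (2 ^ (k + ℓ) + i) = 3 ^ (k + ℓ) + Nat.nth (· ∈ B) i := by
    intro k hk i hi
    rw [← hcount k hk] at hi ⊢
    exact nth_count_add (p := fun n => n ∈ B) hinf (fun x hx => hshift hk hx) hi
  have hnth_zero : Nat.nth (· ∈ B) 0 = 0 := Nat.nth_zero_of_zero h0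
  have hnth_pow : ∀ k ≥ K, Nat.nth (· ∈ B) (2 ^ (k + ℓ)) = 3 ^ (k + ℓ) := fun k hk => by
    simpa [hnth_zero] using hnth_add k hk 0 (by positivity)
  have hmax : 3 ^ (K + ℓ) ≤ 2 * Nat.nth (· ∈ B) (2 ^ (K + ℓ) - 1) + 1 := by
    obtain ⟨y, hy, z, hz, hzy, hyz⟩ := (hmod K).2.2 (-1)
    have hy_le : y ≤ Nat.nth (· ∈ B) (2 ^ (K + ℓ) - 1) := by
      have hyB : y ∈ B := hsub K hy
      have hyn : Nat.nth (· ∈ B) (Nat.count (· ∈ B) y) = y := Nat.nth_count hyB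
      rw [← hyn]
      refine Nat.nth_monotone hinf (Nat.le_sub_one_of_lt ?_)
      rw [← hcount K le_rfl]
      exact Nat.count_strict_mono (p := fun n => n ∈ B) hyB (hlt K le_rfl y hy)
    have hle := Int.le_of_dvd (by omega) hyz.dvd
    zify at hy_le ⊢
    push_cast at hle
    linarith
  have hchar : ∀ k ≥ K, Nat.nth (· ∈ B) (2 ^ (k + ℓ)) +
      (2 * Nat.nth (· ∈ B) (2 ^ (K + ℓ) - 1) + 1 - 3 ^ (K + ℓ)) =
        2 * Nat.nth (· ∈ B) (2 ^ (k + ℓ) - 1) + 1 := by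
    intro k hk
    rw [hnth_pow k hk]
    induction k, hk using Nat.le_induction with
    | base => omega
    | succ k hk ih =>
      have h2 : 2 ^ (k + 1 + ℓ) - 1 = 2 ^ (k + ℓ) + (2 ^ (k + ℓ) - 1) := by
        have : 2 ^ (k + 1 + ℓ) = 2 * 2 ^ (k + ℓ) := by ring
        have : 0 < 2 ^ (k + ℓ) := by positivity
        omega
      have h3 : 3 ^ (k + 1 + ℓ) = 3 * 3 ^ (k + ℓ) := by ring
      rw [h2, hnth_add k hk _ (Nat.sub_lt (by positivity) one_pos), h3]
      omega
  refine ⟨(Finset.range (3 ^ (K + ℓ) + 1)).filter (· ∈ B), by simpa using h0,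
    hfree.mono fun x hx => (Finset.mem_filter.1 hx).2,
    ⟨2 * Nat.nth (· ∈ B) (2 ^ (K + ℓ) - 1) + 1 - 3 ^ (K + ℓ), K + ℓ, fun m hm => ?_⟩, hset⟩
  obtain ⟨k, rfl⟩ := Nat.exists_eq_add_of_le' (le_of_add_le_right hm)
  have hk : K ≤ k := by omega
  simp only [stanleySeq, hset]
  refine ⟨fun i hi => ?_, hchar k hk⟩
  rw [hnth_pow k hk]
  exact hnth_add k hk i hi
end

section
/- Every nonnegative integer λ with λ ≡ 0 (mod 6) or λ ≡ 2 (mod 6) can be achieved as the character of an independent Stanley sequence; moreover such characters can be achieved by basic Stanley sequences. -/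
/-- The natural numbers whose ternary expansion avoids the digit `2`. -/
def noTwoSet : Set ℕ := {n | 2 ∉ Nat.digits 3 n}

/-- The sums of distinct elements of `{u, 3, 9, 27, …}`. -/
def shiftedNoTwo (u : ℕ) : Set ℕ :=
  {n | ∃ s ∈ noTwoSet, n = 3 * s ∨ n = u + 3 * s}

open Classical in
/-- The elements of `T` that are at most `m`. -/
noncomputable def initialSegment (T : Set ℕ) (m : ℕ) : Finset ℕ :=
  (Finset.range (m + 1)).filter (· ∈ T)

theorem mem_initialSegment {T : Set ℕ} {m x : ℕ} :
    x ∈ initialSegment T m ↔ x ≤ m ∧ x ∈ T := by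
  simp [initialSegment]

theorem zero_mem_noTwoSet : 0 ∈ noTwoSet := by simp [noTwoSet]

theorem three_mul_mem_noTwoSet {n : ℕ} : 3 * n ∈ noTwoSet ↔ n ∈ noTwoSet := by
  rcases Nat.eq_zero_or_pos n with rfl | hn
  · simp
  · simp only [noTwoSet, Set.mem_ofPred_eq]
    rw [Nat.digits_def' (by norm_num) (by omega), show 3 * n % 3 = 0 by omega,
      show 3 * n / 3 = n by omega]
    simp

theorem three_mul_add_one_mem_noTwoSet {n : ℕ} : 3 * n + 1 ∈ noTwoSet ↔ n ∈ noTwoSet := by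
  simp only [noTwoSet, Set.mem_ofPred_eq]
  rw [Nat.digits_def' (by norm_num) (by omega), show (3 * n + 1) % 3 = 1 by omega,
    show (3 * n + 1) / 3 = n by omega]
  simp

theorem three_mul_add_two_notMem_noTwoSet {n : ℕ} : 3 * n + 2 ∉ noTwoSet := by
  simp only [noTwoSet, Set.mem_ofPred_eq]
  rw [Nat.digits_def' (by norm_num) (by omega), show (3 * n + 2) % 3 = 2 by omega]
  simp

theorem noTwoSet_eq_shiftedNoTwo_one : noTwoSet = shiftedNoTwo 1 := by
  ext n
  constructor
  · intro hn
    obtain ⟨m, rfl | rfl | rfl⟩ : ∃ m, n = 3 * m ∨ n = 3 * m + 1 ∨ n = 3 * m + 2 :=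
      ⟨n / 3, by omega⟩
    · exact ⟨m, three_mul_mem_noTwoSet.1 hn, Or.inl rfl⟩
    · exact ⟨m, three_mul_add_one_mem_noTwoSet.1 hn, Or.inr (by omega)⟩
    · exact absurd hn three_mul_add_two_notMem_noTwoSet
  · rintro ⟨s, hs, rfl | rfl⟩
    · exact three_mul_mem_noTwoSet.2 hs
    · rw [add_comm]
      exact three_mul_add_one_mem_noTwoSet.2 hs

theorem threeAPFree_noTwoSet : ThreeAPFree noTwoSet := by
  intro x hx y hy z hz h
  induction y using Nat.strong_induction_on generalizing x z with
  | _ y ih =>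
    rcases Nat.eq_zero_or_pos y with rfl | hy0
    · omega
    rw [noTwoSet_eq_shiftedNoTwo_one] at hx hy hz
    obtain ⟨a, ha, hxa⟩ := hx
    obtain ⟨b, hb, hyb⟩ := hy
    obtain ⟨c, hc, hzc⟩ := hz
    have := ih b (by omega) ha hb hc (by omega)
    omega

theorem exists_noTwoSet_cover (w : ℕ) :
    ∃ s ∈ noTwoSet, ∃ t ∈ noTwoSet, t ≤ s ∧ w + t = s + s := by
  induction w using Nat.strong_induction_on with
  | _ w ih =>
    rcases Nat.eq_zero_or_pos w with rfl | hw
    · exact ⟨0, zero_mem_noTwoSet, 0, zero_mem_noTwoSet, le_rfl, rfl⟩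
    · obtain ⟨s, hs, t, ht, hts, h⟩ := ih (w / 3) (by omega)
      obtain hr | hr | hr : w % 3 = 0 ∨ w % 3 = 1 ∨ w % 3 = 2 := by omega
      · exact ⟨3 * s, three_mul_mem_noTwoSet.2 hs, 3 * t, three_mul_mem_noTwoSet.2 ht,
          by omega, by omega⟩
      · exact ⟨3 * s + 1, three_mul_add_one_mem_noTwoSet.2 hs, 3 * t + 1,
          three_mul_add_one_mem_noTwoSet.2 ht, by omega, by omega⟩
      · exact ⟨3 * s + 1, three_mul_add_one_mem_noTwoSet.2 hs, 3 * t,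
          three_mul_mem_noTwoSet.2 ht, by omega, by omega⟩

theorem two_mul_lt_of_mem_noTwoSet {k n : ℕ} (hn : n ∈ noTwoSet) (h : n < 3 ^ k) :
    2 * n < 3 ^ k := by
  induction k generalizing n with
  | zero => simp at h ⊢; omega
  | succ k ih =>
    rw [noTwoSet_eq_shiftedNoTwo_one] at hn
    obtain ⟨s, hs, hns⟩ := hn
    rw [pow_succ] at h ⊢
    have := ih hs (by omega)
    omega

theorem pow_add_mem_noTwoSet {k n : ℕ} (h : n < 3 ^ k) :
    3 ^ k + n ∈ noTwoSet ↔ n ∈ noTwoSet := by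
  induction k generalizing n with
  | zero =>
    obtain rfl : n = 0 := by simpa using h
    simpa using three_mul_add_one_mem_noTwoSet (n := 0)
  | succ k ih =>
    rw [pow_succ] at h ⊢
    obtain ⟨m, hm⟩ : ∃ m, n = 3 * m ∨ n = 3 * m + 1 ∨ n = 3 * m + 2 := ⟨n / 3, by omega⟩
    have := ih (n := m) (by omega)
    rcases hm with rfl | rfl | rfl
    · rw [show 3 ^ k * 3 + 3 * m = 3 * (3 ^ k + m) by ring, three_mul_mem_noTwoSet,
        three_mul_mem_noTwoSet, this]
    · rw [show 3 ^ k * 3 + (3 * m + 1) = 3 * (3 ^ k + m) + 1 by ring,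
        three_mul_add_one_mem_noTwoSet, three_mul_add_one_mem_noTwoSet, this]
    · rw [show 3 ^ k * 3 + (3 * m + 2) = 3 * (3 ^ k + m) + 2 by ring]
      exact iff_of_false three_mul_add_two_notMem_noTwoSet three_mul_add_two_notMem_noTwoSet

theorem pow_mem_noTwoSet (k : ℕ) : 3 ^ k ∈ noTwoSet := by
  simpa using (pow_add_mem_noTwoSet (pow_pos (by norm_num : 0 < 3) k)).2 zero_mem_noTwoSet

theorem half_pow_mem_noTwoSet (k : ℕ) : ∃ s ∈ noTwoSet, 2 * s + 1 = 3 ^ k := by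
  induction k with
  | zero => exact ⟨0, zero_mem_noTwoSet, rfl⟩
  | succ k ih =>
    obtain ⟨s, hs, h⟩ := ih
    exact ⟨3 * s + 1, three_mul_add_one_mem_noTwoSet.2 hs, by rw [pow_succ]; omega⟩

theorem noTwoSet_eq_sums : noTwoSet = {x | ∃ F : Finset ℕ, x = ∑ k ∈ F, 3 ^ k} := by
  ext n
  constructor
  · intro hn
    induction n using Nat.strong_induction_on with
    | _ n ih =>
      rcases Nat.eq_zero_or_pos n with rfl | h0
      · exact ⟨∅, by simp⟩
      rw [noTwoSet_eq_shiftedNoTwo_one] at hn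
      obtain ⟨s, hs, hns⟩ := hn
      obtain ⟨F, hF⟩ := ih s (by omega) hs
      have hsum : ∑ k ∈ F.map ⟨Nat.succ, Nat.succ_injective⟩, 3 ^ k = 3 * s := by
        simp [hF, Finset.mul_sum, pow_succ, mul_comm]
      rcases hns with rfl | rfl
      · exact ⟨_, hsum.symm⟩
      · exact ⟨insert 0 (F.map ⟨Nat.succ, Nat.succ_injective⟩), by
          rw [Finset.sum_insert (by simp), hsum, pow_zero]⟩
  · rintro ⟨F, rfl⟩
    induction F using Finset.induction_on_max with
    | empty => simpa using zero_mem_noTwoSet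
    | insert a F hF ih =>
      rw [Finset.sum_insert fun h => (hF a h).false]
      exact (pow_add_mem_noTwoSet (Nat.geomSum_lt (by norm_num) hF)).2 ih

theorem zero_mem_shiftedNoTwo (u : ℕ) : 0 ∈ shiftedNoTwo u :=
  ⟨0, zero_mem_noTwoSet, Or.inl rfl⟩

theorem pow_succ_mem_shiftedNoTwo (u k : ℕ) : 3 ^ (k + 1) ∈ shiftedNoTwo u :=
  ⟨3 ^ k, pow_mem_noTwoSet k, Or.inl (by ring)⟩

theorem threeAPFree_shiftedNoTwo {u : ℕ} (hu : u % 3 ≠ 0) :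
    ThreeAPFree (shiftedNoTwo u) := by
  rintro x ⟨a, ha, hxa⟩ y ⟨b, hb, hyb⟩ z ⟨c, hc, hzc⟩ h
  have := threeAPFree_noTwoSet ha hb hc (by omega)
  omega

theorem exists_shiftedNoTwo_cover {u x : ℕ} (hu : u % 3 ≠ 0) (hx : 2 * u ≤ x)
    (hxu : x ∉ shiftedNoTwo u) :
    ∃ y ∈ shiftedNoTwo u, ∃ z ∈ shiftedNoTwo u, z < y ∧ x + z = y + y := by
  obtain hr | hr | hr : x % 3 = 0 ∨ x % 3 = u % 3 ∨ x % 3 = 2 * u % 3 := by omega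
  · obtain ⟨s, hs, t, ht, hts, h⟩ := exists_noTwoSet_cover (x / 3)
    refine ⟨3 * s, ⟨s, hs, Or.inl rfl⟩, 3 * t, ⟨t, ht, Or.inl rfl⟩, ?_, by omega⟩
    by_contra hlt
    exact hxu ⟨s, hs, by omega⟩
  · obtain ⟨s, hs, t, ht, hts, h⟩ := exists_noTwoSet_cover ((x - u) / 3)
    refine ⟨u + 3 * s, ⟨s, hs, Or.inr rfl⟩, u + 3 * t, ⟨t, ht, Or.inr rfl⟩, ?_, by omega⟩
    by_contra hlt
    exact hxu ⟨s, hs, by omega⟩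
  · obtain ⟨s, hs, t, ht, hts, h⟩ := exists_noTwoSet_cover ((x - 2 * u) / 3)
    exact ⟨u + 3 * s, ⟨s, hs, Or.inr rfl⟩, 3 * t, ⟨t, ht, Or.inl rfl⟩, by omega, by omega⟩

theorem stanleyNext_initialSegment {T : Set ℕ} (hT : ThreeAPFree T) {M N : ℕ} (hM : M ∈ T)
    (hcover : ∀ x > M, x ∉ T → ∃ y ∈ T, ∃ z ∈ T, z < y ∧ x + z = y + y)
    (hN : N ∈ T) (hMN : M < N) (hmin : ∀ x ∈ T, M < x → N ≤ x) :
    stanleyNext (initialSegment T M) = N := by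
  refine IsLeast.csInf_eq ⟨⟨fun s hs => ?_, ?_⟩, ?_⟩
  · exact (mem_initialSegment.1 hs).1.trans_lt hMN
  · exact hT.mono (Set.insert_subset hN fun x hx => (mem_initialSegment.1 hx).2)
  · rintro x ⟨hx, hfree⟩
    have hMx : M < x := hx M (mem_initialSegment.2 ⟨le_rfl, hM⟩)
    by_cases hxT : x ∈ T
    · exact hmin x hxT hMx
    by_contra! hxN
    obtain ⟨y, hy, z, hz, hzy, h⟩ := hcover x hMx hxT
    have hle : ∀ w ∈ T, w < x → w ∈ (initialSegment T M : Set ℕ) := fun w hw hwx =>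
      mem_initialSegment.2 ⟨by
        by_contra! hMw
        have := hmin w hw hMw
        omega, hw⟩
    have := hfree (Set.mem_insert _ _) (Set.mem_insert_of_mem _ (hle y hy (by omega)))
      (Set.mem_insert_of_mem _ (hle z hz (by omega))) h
    omega

/-- A 3-AP-free set that eventually covers its complement is a Stanley sequence. -/
theorem stanleySet_initialSegment {T : Set ℕ} (hT : ThreeAPFree T) (hinf : T.Infinite) {m : ℕ}
    (hm : m ∈ T) (hcover : ∀ x > m, x ∉ T → ∃ y ∈ T, ∃ z ∈ T, z < y ∧ x + z = y + y) :
    stanleySet (initialSegment T m) = T := by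
  have hiter : ∀ n, ∃ M ∈ T, m + n ≤ M ∧
      stanleyIter (initialSegment T m) n = initialSegment T M := by
    intro n
    induction n with
    | zero => exact ⟨m, hm, le_rfl, rfl⟩
    | succ n ih =>
      obtain ⟨M, hM, hmM, hiter⟩ := ih
      classical
      have hex : ∃ N, N ∈ T ∧ M < N := hinf.exists_gt M
      obtain ⟨hN, hMN⟩ := Nat.find_spec hex
      have hmin : ∀ x ∈ T, M < x → Nat.find hex ≤ x := fun x hx hMx =>
        Nat.find_min' hex ⟨hx, hMx⟩
      refine ⟨Nat.find hex, hN, by omega, ?_⟩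
      rw [stanleyIter, hiter, stanleyNext_initialSegment hT hM
        (fun x hx => hcover x (by omega)) hN hMN hmin]
      ext x
      simp only [Finset.mem_insert, mem_initialSegment]
      constructor
      · rintro (rfl | ⟨h, hx⟩)
        · exact ⟨le_rfl, hN⟩
        · exact ⟨by omega, hx⟩
      · rintro ⟨h, hx⟩
        by_cases hMx : M < x
        · exact Or.inl (le_antisymm h (hmin x hx hMx))
        · exact Or.inr ⟨by omega, hx⟩
  ext x
  simp only [stanleySet, Set.mem_iUnion, Finset.mem_coe]
  constructor
  · rintro ⟨n, hn⟩
    obtain ⟨M, -, -, h⟩ := hiter n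
    rw [h] at hn
    exact (mem_initialSegment.1 hn).2
  · intro hx
    obtain ⟨M, -, hM, h⟩ := hiter x
    exact ⟨x, by rw [h]; exact mem_initialSegment.2 ⟨by omega, hx⟩⟩

theorem infinite_shiftedNoTwo (u : ℕ) : (shiftedNoTwo u).Infinite :=
  Set.infinite_of_forall_exists_gt fun n =>
    ⟨3 ^ (n + 1), pow_succ_mem_shiftedNoTwo u n,
      (Nat.lt_succ_self n).trans (Nat.lt_pow_self (by norm_num))⟩

theorem stanleySet_shiftedNoTwo {u : ℕ} (hu : u % 3 ≠ 0) :
    stanleySet (initialSegment (shiftedNoTwo u) (3 ^ (u + 1))) = shiftedNoTwo u := by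
  refine stanleySet_initialSegment (threeAPFree_shiftedNoTwo hu) (infinite_shiftedNoTwo u)
    (pow_succ_mem_shiftedNoTwo u u) fun x hx => exists_shiftedNoTwo_cover hu ?_
  have : u < 3 ^ u := Nat.lt_pow_self (by norm_num)
  rw [pow_succ] at hx
  omega

theorem shiftedNoTwo_eq_sums (u : ℕ) : shiftedNoTwo u =
    {x | ∃ F : Finset ℕ, x = ∑ k ∈ F, if k = 0 then u else 3 ^ k} := by
  have hsucc : ∀ F : Finset ℕ, (∑ k ∈ F.map ⟨Nat.succ, Nat.succ_injective⟩,
      if k = 0 then u else 3 ^ k) = 3 * ∑ k ∈ F, 3 ^ k := by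
    intro F
    simp [Finset.mul_sum, pow_succ, mul_comm]
  ext n
  constructor
  · rintro ⟨s, hs, hn⟩
    rw [noTwoSet_eq_sums] at hs
    obtain ⟨F, rfl⟩ := hs
    rcases hn with rfl | rfl
    · exact ⟨_, (hsucc F).symm⟩
    · exact ⟨insert 0 (F.map ⟨Nat.succ, Nat.succ_injective⟩), by
        rw [Finset.sum_insert (by simp), hsucc, if_pos rfl]⟩
  · rintro ⟨F, rfl⟩
    have herase : F.erase 0 =
        ((F.erase 0).image Nat.pred).map ⟨Nat.succ, Nat.succ_injective⟩ := by
      ext k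
      simp only [Finset.mem_map, Finset.mem_image, Function.Embedding.coeFn_mk]
      constructor
      · intro hk
        exact ⟨k.pred, ⟨k, hk, rfl⟩, Nat.succ_pred (Finset.ne_of_mem_erase hk)⟩
      · rintro ⟨_, ⟨j, hj, rfl⟩, rfl⟩
        rwa [Nat.succ_eq_add_one, Nat.pred_eq_sub_one,
          Nat.sub_add_cancel (Nat.pos_of_ne_zero (Finset.ne_of_mem_erase hj))]
    refine ⟨∑ k ∈ (F.erase 0).image Nat.pred, 3 ^ k, ?_, ?_⟩
    · rw [noTwoSet_eq_sums]
      exact ⟨_, rfl⟩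
    · rw [← hsucc, ← herase]
      by_cases h0 : 0 ∈ F
      · exact Or.inr (by rw [← Finset.add_sum_erase _ _ h0, if_pos rfl])
      · exact Or.inl (by rw [Finset.erase_eq_of_notMem h0])

theorem two_mul_lt_of_mem_shiftedNoTwo {u k n : ℕ} (hn : n ∈ shiftedNoTwo u)
    (h : n < 3 ^ (k + 1)) : 2 * n + 3 ≤ 2 * u + 3 ^ (k + 1) := by
  obtain ⟨s, hs, hns⟩ := hn
  rw [pow_succ] at h ⊢
  have := two_mul_lt_of_mem_noTwoSet (k := k) hs (by omega)
  omega

theorem pow_add_mem_shiftedNoTwo {u k n : ℕ} (hu : 2 * u < 3 ^ (k + 1)) (h : n < 3 ^ (k + 1)) :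
    3 ^ (k + 1) + n ∈ shiftedNoTwo u ↔ n ∈ shiftedNoTwo u := by
  rw [pow_succ] at hu h ⊢
  constructor
  · rintro ⟨s, hs, hns⟩
    have hlt : 3 ^ k ≤ s := by
      by_contra! hlt
      have := two_mul_lt_of_mem_noTwoSet hs hlt
      omega
    obtain ⟨t, rfl⟩ := Nat.exists_eq_add_of_le hlt
    exact ⟨t, (pow_add_mem_noTwoSet (by omega)).1 hs, by omega⟩
  · rintro ⟨s, hs, hns⟩
    exact ⟨3 ^ k + s, (pow_add_mem_noTwoSet (by omega)).2 hs, by omega⟩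

open Classical in
theorem count_shiftedNoTwo_of_count_noTwoSet {u k : ℕ} (hu : u % 3 ≠ 0)
    (huk : 2 * u < 3 ^ (k + 1)) (hc : Nat.count (· ∈ noTwoSet) (3 ^ k) = 2 ^ k) :
    Nat.count (· ∈ shiftedNoTwo u) (3 ^ (k + 1)) = 2 ^ (k + 1) := by
  rw [Nat.count_eq_card_filter_range] at hc ⊢
  set C := (Finset.range (3 ^ k)).filter (· ∈ noTwoSet) with hC
  have hsplit : (Finset.range (3 ^ (k + 1))).filter (· ∈ shiftedNoTwo u) =
      C.image (fun s => 3 * s) ∪ C.image (fun s => u + 3 * s) := by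
    ext n
    simp only [hC, Finset.mem_filter, Finset.mem_range, Finset.mem_union, Finset.mem_image]
    rw [pow_succ] at huk ⊢
    constructor
    · rintro ⟨hn, s, hs, rfl | rfl⟩
      · exact Or.inl ⟨s, ⟨by omega, hs⟩, rfl⟩
      · exact Or.inr ⟨s, ⟨by omega, hs⟩, rfl⟩
    · rintro (⟨s, ⟨hlt, hs⟩, rfl⟩ | ⟨s, ⟨hlt, hs⟩, rfl⟩)
      · exact ⟨by omega, s, hs, Or.inl rfl⟩
      · have := two_mul_lt_of_mem_noTwoSet hs hlt
        exact ⟨by omega, s, hs, Or.inr rfl⟩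
  rw [hsplit, Finset.card_union_of_disjoint, Finset.card_image_of_injective,
    Finset.card_image_of_injective, hc, pow_succ, mul_two]
  · intro a b h
    simpa using h
  · intro a b h
    simpa using h
  · rw [Finset.disjoint_left]
    intro n h₁ h₂
    obtain ⟨s, -, hs⟩ := Finset.mem_image.1 h₁
    obtain ⟨t, -, ht⟩ := Finset.mem_image.1 h₂
    omega

open Classical in
theorem count_noTwoSet (k : ℕ) : Nat.count (· ∈ noTwoSet) (3 ^ k) = 2 ^ k := by
  induction k with
  | zero => rw [pow_zero, pow_zero, ← zero_add 1, Nat.count_succ, Nat.count_zero,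
      if_pos zero_mem_noTwoSet]
  | succ k ih =>
    have := count_shiftedNoTwo_of_count_noTwoSet (u := 1) (by norm_num)
      (by rw [pow_succ]; have := pow_pos (by norm_num : 0 < 3) k; omega) ih
    rwa [← noTwoSet_eq_shiftedNoTwo_one] at this

theorem isIndependent_nth_shiftedNoTwo {u : ℕ} (hu : u % 3 ≠ 0) :
    IsIndependent (Nat.nth (· ∈ shiftedNoTwo u)) (2 * (u - 1)) := by
  classical
  refine ⟨u + 1, fun k hk => ?_⟩
  obtain ⟨k, rfl⟩ : ∃ j, k = j + 1 := ⟨k - 1, by omega⟩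
  have huk : 2 * u < 3 ^ (k + 1) := by
    have : k < 3 ^ k := Nat.lt_pow_self (by norm_num)
    rw [pow_succ]
    omega
  have hcount := count_shiftedNoTwo_of_count_noTwoSet hu huk (count_noTwoSet k)
  have hpow : Nat.nth (· ∈ shiftedNoTwo u) (2 ^ (k + 1)) = 3 ^ (k + 1) := by
    rw [← hcount]
    exact Nat.nth_count (pow_succ_mem_shiftedNoTwo u k)
  rw [hpow]
  constructor
  · intro i hi
    have hlt : Nat.nth (· ∈ shiftedNoTwo u) i < 3 ^ (k + 1) :=
      Nat.nth_lt_of_lt_count (hi.trans_eq hcount.symm)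
    have hmem : Nat.nth (· ∈ shiftedNoTwo u) i ∈ shiftedNoTwo u :=
      Nat.nth_mem_of_infinite (infinite_shiftedNoTwo u) i
    have hi' : Nat.count (· ∈ shiftedNoTwo u) (Nat.nth (· ∈ shiftedNoTwo u) i) = i :=
      Nat.count_nth_of_infinite (infinite_shiftedNoTwo u) i
    set y := Nat.nth (· ∈ shiftedNoTwo u) i
    have hadd : Nat.count (· ∈ shiftedNoTwo u) (3 ^ (k + 1) + y) = 2 ^ (k + 1) + i := by
      rw [Nat.count_add, hcount]
      congr 1
      refine Eq.trans ?_ hi'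
      simp only [Nat.count_eq_card_filter_range]
      congr 1
      refine Finset.filter_congr fun j hj => pow_add_mem_shiftedNoTwo huk ?_
      exact (Finset.mem_range.1 hj).trans hlt
    rw [← hadd]
    exact Nat.nth_count ((pow_add_mem_shiftedNoTwo huk hlt).2 hmem)
  · obtain ⟨s, hs, hsk⟩ := half_pow_mem_noTwoSet k
    have hmem : u + 3 * s ∈ shiftedNoTwo u := ⟨s, hs, Or.inr rfl⟩
    have hlast : Nat.count (· ∈ shiftedNoTwo u) (u + 3 * s + 1) = 2 ^ (k + 1) := by
      rw [← hcount]
      simp only [Nat.count_eq_card_filter_range]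
      congr 1
      ext n
      simp only [Finset.mem_filter, Finset.mem_range, and_congr_left_iff]
      intro hn
      constructor
      · intro h
        rw [pow_succ] at huk ⊢
        omega
      · intro h
        have := two_mul_lt_of_mem_shiftedNoTwo hn h
        rw [pow_succ] at this
        omega
    have hnth : Nat.nth (· ∈ shiftedNoTwo u) (2 ^ (k + 1) - 1) = u + 3 * s := by
      rw [← hlast, Nat.count_succ, if_pos hmem, Nat.add_sub_cancel]
      exact Nat.nth_count hmem
    rw [hnth, pow_succ]
    omega

/-- Every nonnegative integer `lam ≡ 0` or `2 (mod 6)` is the character of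
an independent Stanley sequence, which may moreover be taken to be basic. -/
theorem zero_or_two_mod_six_isCharacter_basic (lam : ℕ)
    (h : lam % 6 = 0 ∨ lam % 6 = 2) :
    ∃ A : Finset ℕ, 0 ∈ A ∧ ThreeAPFree (A : Set ℕ) ∧
      IsIndependent (stanleySeq A) lam ∧ ∃ b : ℕ → ℕ, IsBasicSequence A b := by
  have hu : (lam / 2 + 1) % 3 ≠ 0 := by omega
  have hT := stanleySet_shiftedNoTwo hu
  refine ⟨initialSegment (shiftedNoTwo (lam / 2 + 1)) (3 ^ (lam / 2 + 1 + 1)), ?_, ?_, ?_,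
    fun k => if k = 0 then lam / 2 + 1 else 3 ^ k, ⟨1, 1, fun k hk => ?_⟩, ?_⟩
  · exact mem_initialSegment.2 ⟨Nat.zero_le _, zero_mem_shiftedNoTwo _⟩
  · exact (threeAPFree_shiftedNoTwo hu).mono fun x hx => (mem_initialSegment.1 hx).2
  · have hseq : stanleySeq (initialSegment (shiftedNoTwo (lam / 2 + 1))
        (3 ^ (lam / 2 + 1 + 1))) = Nat.nth (· ∈ shiftedNoTwo (lam / 2 + 1)) := by
      funext n
      rw [stanleySeq, hT]
    have hlam : lam = 2 * (lam / 2 + 1 - 1) := by omega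
    rw [hseq]
    nth_rewrite 2 [hlam]
    exact isIndependent_nth_shiftedNoTwo hu
  · simp [show k ≠ 0 by omega]
  · rw [hT, shiftedNoTwo_eq_sums]
end

section
/- Every nonnegative integer λ with λ ≡ 4 (mod 6) and λ ≢ 244 (mod 486) can be achieved as the character of an independent Stanley sequence. -/
/-! ### Integers whose ternary digits are at most one -/

/-- All ternary digits of `x` are `0` or `1`. -/
def TernaryBinary (x : ℕ) : Prop := ∀ i, x / 3 ^ i % 3 ≤ 1

namespace TernaryBinary

theorem iff_mod_div (x : ℕ) : TernaryBinary x ↔ x % 3 ≤ 1 ∧ TernaryBinary (x / 3) := by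
  constructor
  · intro h
    refine ⟨by simpa using h 0, fun i => ?_⟩
    rw [Nat.div_div_eq_div_mul, ← pow_succ']
    exact h (i + 1)
  · rintro ⟨h0, h⟩ (_ | i)
    · simpa using h0
    · rw [pow_succ', ← Nat.div_div_eq_div_mul]
      exact h i

theorem zero : TernaryBinary 0 := fun i => by simp

theorem three_mul_add {s d : ℕ} (hs : TernaryBinary s) (hd : d ≤ 1) :
    TernaryBinary (3 * s + d) := by
  rw [iff_mod_div]
  refine ⟨by omega, ?_⟩
  rwa [show (3 * s + d) / 3 = s by omega]

theorem eq_of_add_eq {x y z : ℕ} (hx : TernaryBinary x) (hy : TernaryBinary y)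
    (hz : TernaryBinary z) (h : x + z = y + y) : x = y := by
  induction y using Nat.strong_induction_on generalizing x z with
  | _ y ih =>
    rcases Nat.eq_zero_or_pos y with rfl | hpos
    · omega
    · rw [iff_mod_div] at hx hy hz
      have := ih (y / 3) (by omega) hx.2 hy.2 hz.2 (by omega)
      have hx0 : x % 3 = 0 ∨ x % 3 = 1 := by omega
      have hy0 : y % 3 = 0 ∨ y % 3 = 1 := by omega
      rcases hx0 with hx0 | hx0 <;> rcases hy0 with hy0 | hy0 <;> omega

theorem exists_add_eq (t : ℕ) :
    ∃ s s', TernaryBinary s ∧ TernaryBinary s' ∧ s' ≤ s ∧ t + s' = 2 * s := by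
  induction t using Nat.strong_induction_on with
  | _ t ih =>
    rcases Nat.eq_zero_or_pos t with rfl | hpos
    · exact ⟨0, 0, zero, zero, le_rfl, rfl⟩
    · obtain ⟨s, s', hs, hs', hle, h⟩ := ih (t / 3) (by omega)
      have : t % 3 = 0 ∨ t % 3 = 1 ∨ t % 3 = 2 := by omega
      rcases this with h3 | h3 | h3
      · exact ⟨3 * s + 0, 3 * s' + 0, hs.three_mul_add (by omega),
          hs'.three_mul_add (by omega), by omega, by omega⟩
      · exact ⟨3 * s + 1, 3 * s' + 1, hs.three_mul_add (by omega),
          hs'.three_mul_add (by omega), by omega, by omega⟩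
      · exact ⟨3 * s + 1, 3 * s' + 0, hs.three_mul_add (by omega),
          hs'.three_mul_add (by omega), by omega, by omega⟩

theorem two_mul_lt {j s : ℕ} (hs : TernaryBinary s) (h : s < 3 ^ j) : 2 * s < 3 ^ j := by
  induction j generalizing s with
  | zero => simp at h; simp [h]
  | succ j ih =>
    rw [iff_mod_div] at hs
    rw [pow_succ] at *
    have := ih hs.2 (by omega)
    omega

theorem pow_add_iff {j s : ℕ} (h : s < 3 ^ j) :
    TernaryBinary (3 ^ j + s) ↔ TernaryBinary s := by
  induction j generalizing s with
  | zero =>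
    obtain rfl : s = 0 := by simpa using h
    exact ⟨fun _ => zero, fun _ => by simpa using zero.three_mul_add (d := 1) le_rfl⟩
  | succ j ih =>
    rw [pow_succ] at *
    rw [iff_mod_div, iff_mod_div s, show (3 ^ j * 3 + s) % 3 = s % 3 by omega,
      show (3 ^ j * 3 + s) / 3 = 3 ^ j + s / 3 by omega, ih (by omega)]

theorem exists_two_mul_add_one_eq (j : ℕ) : ∃ e, TernaryBinary e ∧ 2 * e + 1 = 3 ^ j := by
  induction j with
  | zero => exact ⟨0, zero, rfl⟩
  | succ j ih =>
    obtain ⟨e, he, h⟩ := ih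
    exact ⟨3 * e + 1, he.three_mul_add le_rfl, by rw [pow_succ]; omega⟩

open Classical in
theorem count_pow (j : ℕ) : Nat.count TernaryBinary (3 ^ j) = 2 ^ j := by
  induction j with
  | zero =>
    change Nat.count TernaryBinary (0 + 1) = 1
    rw [Nat.count_succ]
    simp [zero]
  | succ j ih =>
    have h1 : Nat.count (fun k => TernaryBinary (3 ^ j + k)) (3 ^ j) =
        Nat.count TernaryBinary (3 ^ j) := by
      simp only [Nat.count_eq_card_filter_range]
      congr 1
      refine Finset.filter_congr fun s hs => ?_
      exact pow_add_iff (Finset.mem_range.1 hs)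
    have h2 : Nat.count (fun k => TernaryBinary (3 ^ j + 3 ^ j + k)) (3 ^ j) = 0 := by
      rw [Nat.count_eq_card_filter_range, Finset.card_eq_zero, Finset.filter_eq_empty_iff]
      intro s hs hT
      have hs := Finset.mem_range.1 hs
      have := two_mul_lt (j := j + 1) hT (by rw [pow_succ]; omega)
      rw [pow_succ] at this
      omega
    rw [pow_succ, show 3 ^ j * 3 = 3 ^ j + 3 ^ j + 3 ^ j by ring, Nat.count_add, Nat.count_add,
      h1, h2, ih]
    ring

end TernaryBinary

/-! ### Recognising Stanley sequences and their independence -/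

section Recognition

variable {p : ℕ → Prop}

open Classical in
theorem stanleySet_filter_range_eq (hinf : {x | p x}.Infinite) (hfree : ThreeAPFree {x | p x})
    {t : ℕ} (ht : p t)
    (hcov : ∀ x, t ≤ x → ¬ p x → ∃ y z, p y ∧ p z ∧ z < y ∧ y < x ∧ x + z = 2 * y) :
    stanleySet ((Finset.range (t + 1)).filter p) = {x | p x} := by
  have hmem (n x : ℕ) : x ∈ (Finset.range n).image (Nat.nth p) ↔ p x ∧ Nat.count p x < n := by
    simp only [Finset.mem_image, Finset.mem_range]
    constructor
    · rintro ⟨i, hi, rfl⟩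
      exact ⟨Nat.nth_mem_of_infinite hinf i, by rwa [Nat.count_nth_of_infinite hinf]⟩
    · rintro ⟨hx, hc⟩
      exact ⟨_, hc, Nat.nth_count hx⟩
  have hiter (n : ℕ) : stanleyIter ((Finset.range (t + 1)).filter p) n =
      (Finset.range (Nat.count p t + 1 + n)).image (Nat.nth p) := by
    induction n with
    | zero =>
      ext x
      rw [hmem]
      simp only [stanleyIter, Finset.mem_filter, Finset.mem_range]
      constructor
      · rintro ⟨hx, hp⟩
        exact ⟨hp, Nat.lt_succ_of_le (Nat.count_monotone p (by omega))⟩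
      · rintro ⟨hp, hc⟩
        refine ⟨?_, hp⟩
        by_contra hlt
        have := Nat.count_strict_mono (p := p) (n := x) ht (by omega)
        omega
    | succ n ih =>
      have hnext : stanleyNext ((Finset.range (Nat.count p t + 1 + n)).image (Nat.nth p)) =
          Nat.nth p (Nat.count p t + 1 + n) := by
        refine IsLeast.csInf_eq ⟨⟨fun s hs => ?_, ?_⟩, fun w hw => ?_⟩
        · obtain ⟨i, hi, rfl⟩ := Finset.mem_image.1 hs
          exact Nat.nth_strictMono hinf (Finset.mem_range.1 hi)
        · refine hfree.mono ?_
          rintro x (rfl | hx)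
          · exact Nat.nth_mem_of_infinite hinf _
          · exact ((hmem _ _).1 hx).1
        · obtain ⟨hgt, hw⟩ := hw
          by_contra! hlt
          have hbelow {y : ℕ} (hy : p y) (hyw : y ≤ w) :
              y ∈ (Finset.range (Nat.count p t + 1 + n)).image (Nat.nth p) := by
            refine (hmem _ _).2 ⟨hy, ?_⟩
            rw [← Nat.nth_lt_nth (p := p) hinf, Nat.nth_count hy]
            omega
          have htw : t < w := hgt t ((hmem _ _).2 ⟨ht, by omega⟩)
          by_cases hpw : p w
          · exact lt_irrefl w (hgt w (hbelow hpw le_rfl))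
          · obtain ⟨y, z, hy, hz, hzy, hyw, h⟩ := hcov w htw.le hpw
            have := hw (Set.mem_insert _ _) (Set.mem_insert_of_mem _ (hbelow hy hyw.le))
              (Set.mem_insert_of_mem _ (hbelow hz (by omega))) (by omega)
            omega
      rw [stanleyIter, ih, hnext, ← add_assoc, Finset.range_add_one, Finset.image_insert]
  ext x
  simp only [stanleySet, hiter, Set.mem_iUnion, Finset.mem_coe, hmem]
  exact ⟨fun ⟨_, h, _⟩ => h, fun h => ⟨Nat.count p x, h, by omega⟩⟩

open Classical in
theorem isIndependent_nth (hinf : {x | p x}.Infinite) (h0 : p 0) {lam χ : ℕ}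
    (h : ∀ k ≥ χ, ∃ L e, Nat.count p L = 2 ^ k ∧ (∀ x < L, p (L + x) ↔ p x) ∧
      p e ∧ e < L ∧ (∀ x < L, p x → x ≤ e) ∧ L + lam = 2 * e + 1) :
    IsIndependent (Nat.nth p) lam := by
  refine ⟨χ, fun k hk => ?_⟩
  obtain ⟨L, e, hcount, hshift, he, heL, hmax, hlam⟩ := h k hk
  have hnth {i : ℕ} (hi : i < 2 ^ k) : Nat.nth p i < L := Nat.nth_lt_of_lt_count (by omega)
  have hL : Nat.nth p (2 ^ k) = L := by
    rw [← hcount]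
    exact Nat.nth_count (by simpa using (hshift 0 (by omega)).2 h0)
  have hlast : Nat.nth p (2 ^ k - 1) = e := by
    have hpos : 0 < 2 ^ k := by positivity
    refine le_antisymm (hmax _ (hnth (by omega)) (Nat.nth_mem_of_infinite hinf _)) ?_
    have := Nat.count_strict_mono he heL
    calc e = Nat.nth p (Nat.count p e) := (Nat.nth_count he).symm
      _ ≤ _ := Nat.nth_monotone hinf (by omega)
  refine ⟨fun i hi => ?_, by rw [hL, hlast]; exact hlam⟩
  have hc : Nat.count p (L + Nat.nth p i) = 2 ^ k + i := by
    have : Nat.count (fun x => p (L + x)) (Nat.nth p i) = Nat.count p (Nat.nth p i) := by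
      simp only [Nat.count_eq_card_filter_range]
      congr 1
      refine Finset.filter_congr fun s hs => hshift s ?_
      exact (Finset.mem_range.1 hs).trans (hnth hi)
    rw [Nat.count_add, this, hcount, Nat.count_nth_of_infinite hinf]
  rw [hL, ← hc]
  exact Nat.nth_count ((hshift _ (hnth hi)).2 (Nat.nth_mem_of_infinite hinf i))

end Recognition

/-! ### Near-modular sets with prescribed maximum -/

/-- `A` is near-modular modulo `N` with largest element `D`. -/
def NearModularWithMax (A : Finset ℕ) (N D : ℕ) : Prop :=
  0 ∈ A ∧ D ∈ A ∧ (∀ a ∈ A, a ≤ D) ∧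
  (∀ x ∈ A, ∀ y ∈ A, ∀ z ∈ A, (x + z) % N = (2 * y) % N → x = y ∧ y = z) ∧
  (∀ r < N, ∃ y ∈ A, ∃ z ∈ A, z ≤ y ∧ (r + z) % N = (2 * y) % N)

/-- The set of all `a + N * s` with `a ∈ A` and `s` having ternary digits `0` and `1`. -/
def ModularSum (A : Finset ℕ) (N x : ℕ) : Prop :=
  ∃ a ∈ A, ∃ s, TernaryBinary s ∧ x = a + N * s

namespace NearModularWithMax

variable {A : Finset ℕ} {N D : ℕ}

theorem eq_of_mod_eq (h : NearModularWithMax A N D) {a b : ℕ} (ha : a ∈ A) (hb : b ∈ A)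
    (hab : a % N = b % N) : a = b := by
  refine (h.2.2.2.1 a ha b hb b hb ?_).1
  rw [two_mul, Nat.add_mod, hab, ← Nat.add_mod]

theorem exists_raise (h : NearModularWithMax A N D) (hD : 0 < D) (k : ℕ) :
    ∃ A' : Finset ℕ, A'.card = A.card ∧ NearModularWithMax A' N (D + N * k) := by
  obtain ⟨h0, hmem, hle, hfree, hcov⟩ := h
  set f : ℕ → ℕ := fun a => if a = D then D + N * k else a with hf
  have hmod (a : ℕ) : f a % N = a % N := by
    by_cases ha : a = D <;> simp [hf, ha]
  have hmono {a b : ℕ} (hb : b ∈ A) (hab : b ≤ a) (ha : a ∈ A) : f b ≤ f a := by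
    have := hle a ha
    simp only [hf]
    split_ifs <;> omega
  have hinj {a b : ℕ} (ha : a ∈ A) (hb : b ∈ A) (hab : f a = f b) : a = b := by
    have := hle a ha
    have := hle b hb
    simp only [hf] at hab
    split_ifs at hab <;> omega
  refine ⟨A.image f, Finset.card_image_of_injOn fun a ha b hb => hinj ha hb, ?_, ?_, ?_, ?_, ?_⟩
  · exact Finset.mem_image.2 ⟨0, h0, by simp [hf, hD.ne]⟩
  · exact Finset.mem_image.2 ⟨D, hmem, by simp [hf]⟩
  · simp only [Finset.forall_mem_image]
    intro a ha
    simpa [hf] using hmono ha (hle a ha) hmem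
  · simp only [Finset.forall_mem_image]
    intro x hx y hy z hz hxyz
    rw [Nat.add_mod, Nat.mul_mod, hmod, hmod, hmod, ← Nat.add_mod, ← Nat.mul_mod] at hxyz
    obtain ⟨rfl, rfl⟩ := hfree x hx y hy z hz hxyz
    exact ⟨rfl, rfl⟩
  · intro r hr
    obtain ⟨y, hy, z, hz, hzy, hr⟩ := hcov r hr
    refine ⟨f y, Finset.mem_image_of_mem f hy, f z, Finset.mem_image_of_mem f hz,
      hmono hz hzy hy, ?_⟩
    rw [Nat.add_mod, Nat.mul_mod, hmod, hmod, ← Nat.add_mod, ← Nat.mul_mod, hr]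

theorem threeAPFree (h : NearModularWithMax A N D) (hN : 0 < N) :
    ThreeAPFree {x | ModularSum A N x} := by
  rintro _ ⟨a, ha, s, hs, rfl⟩ _ ⟨b, hb, t, ht, rfl⟩ _ ⟨c, hc, u, hu, rfl⟩ heq
  have hmod : (a + c) % N = (2 * b) % N := by
    have := congrArg (· % N) heq
    simp only [show a + N * s + (c + N * u) = a + c + N * (s + u) by ring,
      show b + N * t + (b + N * t) = 2 * b + N * (2 * t) by ring,
      Nat.add_mul_mod_self_left] at this
    exact this
  obtain ⟨rfl, rfl⟩ := h.2.2.2.1 a ha b hb c hc hmod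
  have : N * (s + u) = N * (t + t) := by linarith
  rw [hs.eq_of_add_eq ht hu (Nat.eq_of_mul_eq_mul_left hN this)]

theorem covers (h : NearModularWithMax A N D) (hN : 0 < N) {x : ℕ} (hx : 2 * D ≤ x)
    (hxn : ¬ ModularSum A N x) :
    ∃ y z, ModularSum A N y ∧ ModularSum A N z ∧ z < y ∧ y < x ∧ x + z = 2 * y := by
  obtain ⟨a, ha, b, hb, hba, hr⟩ := h.2.2.2.2 (x % N) (Nat.mod_lt _ hN)
  rw [Nat.mod_add_mod] at hr
  have hle : 2 * a ≤ x + b := by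
    have := h.2.2.1 a ha
    omega
  obtain ⟨q, hq⟩ := (Nat.modEq_iff_dvd' hle).1 hr.symm
  obtain ⟨s, s', hs, hs', hss, hqs⟩ := TernaryBinary.exists_add_eq q
  have hmul : N * s' ≤ N * s := Nat.mul_le_mul_left N hss
  have heq : x + (b + N * s') = 2 * (a + N * s) := by
    have : N * q + N * s' = 2 * (N * s) := by rw [← mul_add, hqs]; ring
    omega
  have hne : b + N * s' ≠ a + N * s := fun hba' =>
    hxn ⟨a, ha, s, hs, by omega⟩
  exact ⟨_, _, ⟨a, ha, s, hs, rfl⟩, ⟨b, hb, s', hs', rfl⟩, by omega, by omega, heq⟩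

theorem infinite (h : NearModularWithMax A N D) (hN : 0 < N) :
    {x | ModularSum A N x}.Infinite := by
  refine Set.infinite_of_forall_exists_gt fun n => ?_
  have hT : TernaryBinary (3 ^ n) := by
    simpa using (TernaryBinary.pow_add_iff (j := n) (s := 0) (by positivity)).2 TernaryBinary.zero
  refine ⟨0 + N * 3 ^ n, ⟨0, h.1, _, hT, rfl⟩, ?_⟩
  have := Nat.lt_pow_self (n := n) (a := 3) (by norm_num)
  nlinarith

section Level

variable {j : ℕ}

theorem add_mul_lt (h : NearModularWithMax A N D) (hj : 2 * D < N * 3 ^ j) {a s : ℕ} (ha : a ∈ A)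
    (hs : TernaryBinary s) (hsj : s < 3 ^ j) : a + N * s < N * 3 ^ j := by
  have := h.2.2.1 a ha
  have := Nat.mul_le_mul_left N (hs.two_mul_lt hsj).le
  nlinarith

theorem modularSum_add_iff (h : NearModularWithMax A N D) (hj : 2 * D < N * 3 ^ j)
    {x : ℕ} (hx : x < N * 3 ^ j) :
    ModularSum A N (N * 3 ^ j + x) ↔ ModularSum A N x := by
  constructor
  · rintro ⟨a, ha, s, hs, heq⟩
    have hge : 3 ^ j ≤ s := by
      by_contra! hlt
      have := h.add_mul_lt hj ha hs hlt
      omega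
    obtain ⟨u, rfl⟩ := Nat.exists_eq_add_of_le hge
    rw [mul_add] at heq
    have hu : u < 3 ^ j := Nat.lt_of_mul_lt_mul_left (a := N) (by omega)
    exact ⟨a, ha, u, (TernaryBinary.pow_add_iff hu).1 hs, by omega⟩
  · rintro ⟨a, ha, s, hs, rfl⟩
    have hsj : s < 3 ^ j := Nat.lt_of_mul_lt_mul_left (a := N) (by omega)
    exact ⟨a, ha, 3 ^ j + s, (TernaryBinary.pow_add_iff hsj).2 hs, by ring⟩

open Classical in
theorem count_modularSum (h : NearModularWithMax A N D) (hN : 0 < N) (hj : 2 * D < N * 3 ^ j) :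
    Nat.count (ModularSum A N) (N * 3 ^ j) = A.card * 2 ^ j := by
  rw [← TernaryBinary.count_pow, Nat.count_eq_card_filter_range, Nat.count_eq_card_filter_range,
    ← Finset.card_product]
  symm
  refine Finset.card_bij (fun q _ => q.1 + N * q.2) ?_ ?_ ?_
  · rintro ⟨a, s⟩ hq
    simp only [Finset.mem_product, Finset.mem_filter, Finset.mem_range] at hq ⊢
    exact ⟨h.add_mul_lt hj hq.1 hq.2.2 hq.2.1, a, hq.1, s, hq.2.2, rfl⟩
  · rintro ⟨a, s⟩ hq ⟨b, t⟩ hq' heq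
    simp only [Finset.mem_product, Finset.mem_filter, Finset.mem_range] at hq hq' heq
    have hab : a = b := by
      refine h.eq_of_mod_eq hq.1 hq'.1 ?_
      simpa using congrArg (· % N) heq
    subst hab
    have : s = t := Nat.eq_of_mul_eq_mul_left hN (by omega)
    rw [this]
  · intro x hx
    simp only [Finset.mem_filter, Finset.mem_range] at hx
    obtain ⟨hx, a, ha, s, hs, rfl⟩ := hx
    refine ⟨(a, s), ?_, rfl⟩
    simp only [Finset.mem_product, Finset.mem_filter, Finset.mem_range]
    exact ⟨ha, Nat.lt_of_mul_lt_mul_left (a := N) (by omega), hs⟩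

end Level

theorem isCharacter (h : NearModularWithMax A N D) (hN : 0 < N) {m lam : ℕ}
    (hcard : A.card = 2 ^ m) (hlam : N + lam = 2 * D + 1) : IsCharacter lam := by
  classical
  have hinf := h.infinite hN
  have hfree := h.threeAPFree hN
  have h0 : ModularSum A N 0 := ⟨0, h.1, 0, TernaryBinary.zero, rfl⟩
  obtain ⟨t, ht, hDt⟩ := hinf.exists_gt (2 * D)
  have hset := stanleySet_filter_range_eq hinf hfree ht
    fun x hx hxn => h.covers hN (by omega) hxn
  refine ⟨(Finset.range (t + 1)).filter (ModularSum A N), by simp [h0], hfree.mono ?_, ?_⟩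
  · intro x hx
    exact (Finset.mem_filter.1 hx).2
  have hseq : stanleySeq ((Finset.range (t + 1)).filter (ModularSum A N)) =
      Nat.nth (ModularSum A N) := by
    funext n
    rw [stanleySeq, hset]
    rfl
  rw [hseq]
  refine isIndependent_nth hinf h0 (χ := m + 2 * D) fun k hk => ?_
  obtain ⟨j, rfl⟩ := Nat.exists_eq_add_of_le (show m ≤ k by omega)
  have hj : 2 * D < N * 3 ^ j := by
    have := Nat.lt_pow_self (n := j) (a := 3) (by norm_num)
    nlinarith
  obtain ⟨e, he, hej⟩ := TernaryBinary.exists_two_mul_add_one_eq j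
  refine ⟨N * 3 ^ j, D + N * e, ?_, fun x hx => h.modularSum_add_iff hj hx,
    ⟨D, h.2.1, e, he, rfl⟩, h.add_mul_lt hj h.2.1 he (by omega), ?_, ?_⟩
  · rw [h.count_modularSum hN hj, hcard, pow_add]
  · rintro x hx ⟨a, ha, s, hs, rfl⟩
    have hsj : s < 3 ^ j := Nat.lt_of_mul_lt_mul_left (a := N) (by omega)
    have := hs.two_mul_lt hsj
    have := Nat.mul_le_mul_left N (show s ≤ e by omega)
    have := h.2.2.1 a ha
    omega
  · rw [← hej]
    linarith

theorem isCharacter_of_mod_eq (h : NearModularWithMax A N D) (hN : 0 < N) (hD : 0 < D)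
    {m lam lam₀ : ℕ} (hcard : A.card = 2 ^ m) (hlam₀ : N + lam₀ = 2 * D + 1)
    (hmod : lam % (2 * N) = lam₀) : IsCharacter lam := by
  obtain ⟨A', hA', h'⟩ := h.exists_raise hD (lam / (2 * N))
  refine h'.isCharacter hN (hA'.trans hcard) ?_
  have := Nat.mod_add_div lam (2 * N)
  rw [hmod] at this
  linarith

end NearModularWithMax

/-! ### Explicit near-modular sets -/

/-- The natural number whose binary digits equal to one are at the positions listed in `l`. -/
def bitMask : List ℕ → ℕ
  | [] => 0
  | a :: l => 2 ^ a ||| bitMask l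

theorem testBit_bitMask (l : List ℕ) (i : ℕ) : (bitMask l).testBit i = true ↔ i ∈ l := by
  induction l with
  | nil => simp [bitMask]
  | cons a l ih => simp [bitMask, ih, Nat.testBit_two_pow, @eq_comm _ a i]

/-- A residue `r` modulo `N` with `r + z ≡ 2 * y`. -/
def reflectMod (N y z : ℕ) : ℕ := (2 * y + (N - z % N)) % N

theorem reflectMod_add_modEq {N : ℕ} (hN : 0 < N) (y z : ℕ) :
    reflectMod N y z + z ≡ 2 * y [MOD N] := by
  have hz := Nat.mod_lt z hN
  calc reflectMod N y z + z ≡ 2 * y + (N - z % N) + z % N [MOD N] :=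
        (Nat.mod_modEq _ _).add (Nat.mod_modEq _ _).symm
    _ = 2 * y + N := by omega
    _ ≡ 2 * y [MOD N] := by simp

/-- A test which certifies that the members of `l` form a near-modular set. -/
def nearModularTest (l : List ℕ) (N D : ℕ) : Bool :=
  l.contains 0 && l.contains D && l.all (fun a => Nat.ble a D) &&
  l.all (fun y => l.all fun z =>
    Nat.beq y z || !(bitMask (l.map (· % N))).testBit (reflectMod N y z)) &&
  Nat.beq (2 ^ N - 1)
    (bitMask (l.flatMap fun y => (l.filter fun z => Nat.ble z y).map (reflectMod N y)))

theorem nearModularWithMax_of_test {l : List ℕ} {N D : ℕ} (hN : 0 < N)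
    (h : nearModularTest l N D = true) : NearModularWithMax l.toFinset N D := by
  simp only [nearModularTest, Bool.and_eq_true, List.all_eq_true, Nat.ble_eq, Nat.beq_eq,
    Bool.or_eq_true, Bool.not_eq_true', List.contains_iff_mem] at h
  obtain ⟨⟨⟨⟨h0, hD⟩, hle⟩, hfree⟩, hcov⟩ := h
  have key {x y z : ℕ} (hx : x ∈ l) (hy : y ∈ l) (hz : z ∈ l) (hxyz : (x + z) % N = (2 * y) % N) :
      y = z := by
    refine (hfree y hy z hz).resolve_right fun hbit => ?_
    have hmod : reflectMod N y z ≡ x [MOD N] :=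
      Nat.ModEq.add_right_cancel' z ((reflectMod_add_modEq hN y z).trans hxyz.symm)
    have hval : reflectMod N y z = x % N := by
      rw [← hmod, reflectMod, Nat.mod_mod]
    have := (testBit_bitMask (l.map (· % N)) (reflectMod N y z)).2
      (List.mem_map.2 ⟨x, hx, hval.symm⟩)
    simp [hbit] at this
  simp only [NearModularWithMax, List.mem_toFinset]
  refine ⟨h0, hD, hle, fun x hx y hy z hz hxyz => ?_, fun r hr => ?_⟩
  · exact ⟨(key hz hy hx (by rwa [add_comm])).symm, key hx hy hz hxyz⟩
  · have hbit : (2 ^ N - 1).testBit r = true := by simp [Nat.testBit_two_pow_sub_one, hr]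
    rw [hcov, testBit_bitMask] at hbit
    simp only [List.mem_flatMap, List.mem_map, List.mem_filter, Nat.ble_eq] at hbit
    obtain ⟨y, hy, z, ⟨hz, hzy⟩, rfl⟩ := hbit
    exact ⟨y, hy, z, hz, hzy, reflectMod_add_modEq hN y z⟩

theorem isCharacter_of_mod_18_eq_4 {lam : ℕ} (h : lam % 18 = 4) : IsCharacter lam := by
  have hA : NearModularWithMax (List.toFinset
      [0, 2, 5, 6])
      9 6 :=
    nearModularWithMax_of_test (by norm_num) (by decide +kernel)
  exact hA.isCharacter_of_mod_eq (by norm_num) (by norm_num) (m := 2)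
    (by decide +kernel) (by norm_num) h

theorem isCharacter_of_mod_18_eq_16 {lam : ℕ} (h : lam % 18 = 16) : IsCharacter lam := by
  have hA : NearModularWithMax (List.toFinset
      [0, 1, 4, 12])
      9 12 :=
    nearModularWithMax_of_test (by norm_num) (by decide +kernel)
  exact hA.isCharacter_of_mod_eq (by norm_num) (by norm_num) (m := 2)
    (by decide +kernel) (by norm_num) h

theorem isCharacter_of_mod_54_eq_10 {lam : ℕ} (h : lam % 54 = 10) : IsCharacter lam := by
  have hA : NearModularWithMax (List.toFinset
      [0, 1, 4, 6, 10, 13, 15, 18])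
      27 18 :=
    nearModularWithMax_of_test (by norm_num) (by decide +kernel)
  exact hA.isCharacter_of_mod_eq (by norm_num) (by norm_num) (m := 3)
    (by decide +kernel) (by norm_num) h

theorem isCharacter_of_mod_54_eq_46 {lam : ℕ} (h : lam % 54 = 46) : IsCharacter lam := by
  have hA : NearModularWithMax (List.toFinset
      [0, 1, 3, 4, 10, 13, 21, 36])
      27 36 :=
    nearModularWithMax_of_test (by norm_num) (by decide +kernel)
  exact hA.isCharacter_of_mod_eq (by norm_num) (by norm_num) (m := 3)
    (by decide +kernel) (by norm_num) h

theorem isCharacter_of_mod_162_eq_28 {lam : ℕ} (h : lam % 162 = 28) : IsCharacter lam := by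
  have hA : NearModularWithMax (List.toFinset
      [0, 3, 4, 10, 13, 18, 19, 21, 30, 31, 37, 40, 45, 46, 48, 54])
      81 54 :=
    nearModularWithMax_of_test (by norm_num) (by decide +kernel)
  exact hA.isCharacter_of_mod_eq (by norm_num) (by norm_num) (m := 4)
    (by decide +kernel) (by norm_num) h

theorem isCharacter_of_mod_162_eq_136 {lam : ℕ} (h : lam % 162 = 136) : IsCharacter lam := by
  have hA : NearModularWithMax (List.toFinset
      [0, 9, 15, 51, 56, 63, 65, 69, 71, 80, 83, 92, 98, 105, 107, 108])
      81 108 :=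
    nearModularWithMax_of_test (by norm_num) (by decide +kernel)
  exact hA.isCharacter_of_mod_eq (by norm_num) (by norm_num) (m := 4)
    (by decide +kernel) (by norm_num) h

theorem isCharacter_of_mod_486_eq_82 {lam : ℕ} (h : lam % 486 = 82) : IsCharacter lam := by
  have hA : NearModularWithMax (List.toFinset
      [0, 1, 3, 9, 12, 28, 30, 37, 39, 43, 52, 54, 63, 64, 70, 79, 82, 84, 90, 93, 109,
      111, 118, 120, 124, 133, 135, 144, 145, 151, 160, 162])
      243 162 :=
    nearModularWithMax_of_test (by norm_num) (by decide +kernel)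
  exact hA.isCharacter_of_mod_eq (by norm_num) (by norm_num) (m := 5)
    (by decide +kernel) (by norm_num) h

theorem isCharacter_of_mod_486_eq_406 {lam : ℕ} (h : lam % 486 = 406) : IsCharacter lam := by
  have hA : NearModularWithMax (List.toFinset
      [0, 1, 3, 4, 9, 10, 12, 13, 27, 28, 30, 31, 36, 37, 39, 40, 82, 90, 91, 93, 109,
      117, 118, 120, 165, 166, 175, 189, 192, 193, 202, 324])
      243 324 :=
    nearModularWithMax_of_test (by norm_num) (by decide +kernel)
  exact hA.isCharacter_of_mod_eq (by norm_num) (by norm_num) (m := 5)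
    (by decide +kernel) (by norm_num) h


/-- Every nonnegative integer `lam ≡ 4 (mod 6)` with `lam ≢ 244 (mod 486)`
is the character of an independent Stanley sequence. -/
theorem four_mod_six_not_244_isCharacter (lam : ℕ)
    (h6 : lam % 6 = 4) (h486 : lam % 486 ≠ 244) :
    IsCharacter lam := by
  have hcases : lam % 18 = 4 ∨ lam % 18 = 16 ∨
      lam % 54 = 10 ∨ lam % 54 = 46 ∨
      lam % 162 = 28 ∨ lam % 162 = 136 ∨
      lam % 486 = 82 ∨ lam % 486 = 406 := by
    omega
  rcases hcases with h | h | h | h | h | h | h | h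
  · exact isCharacter_of_mod_18_eq_4 h
  · exact isCharacter_of_mod_18_eq_16 h
  · exact isCharacter_of_mod_54_eq_10 h
  · exact isCharacter_of_mod_54_eq_46 h
  · exact isCharacter_of_mod_162_eq_28 h
  · exact isCharacter_of_mod_162_eq_136 h
  · exact isCharacter_of_mod_486_eq_82 h
  · exact isCharacter_of_mod_486_eq_406 h
end

section
/- If A is a modular set mod N for a positive integer N, then the set of terms of the Stanley sequence S(A) equals A + N·S(0), i.e., { a + N·s : a ∈ A, s a term of S({0}) }. -/
/-- `x` is the largest term of a nontrivial 3-term progression whose other terms lie in `S`. -/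
def IsCoveredBy (S : Set ℕ) (x : ℕ) : Prop :=
  ∃ z ∈ S, ∃ y ∈ S, z < y ∧ x + z = y + y

theorem threeAPFree_insert_of_not_isCoveredBy {S : Set ℕ} {x : ℕ} (hS : ThreeAPFree S)
    (hlt : ∀ s ∈ S, s < x) (hx : ¬ IsCoveredBy S x) : ThreeAPFree (insert x S) := by
  have key : ∀ z ∈ S, ∀ y ∈ S, x + z ≠ y + y := fun z hz y hy h ↦
    hx ⟨z, hz, y, hy, by have := hlt y hy; omega, h⟩
  rintro a (rfl | ha) b (rfl | hb) c (rfl | hc) h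
  · rfl
  · rfl
  · have := hlt b hb; omega
  · exact (key c hc b hb h).elim
  · have := hlt a ha; omega
  · have := hlt a ha; have := hlt c hc; omega
  · exact (key a ha b hb (by omega)).elim
  · exact hS ha hb hc h

theorem ThreeAPFree.not_isCoveredBy {S : Set ℕ} (hS : ThreeAPFree S) {x : ℕ} (hx : x ∈ S) :
    ¬ IsCoveredBy S x := by
  rintro ⟨z, hz, y, hy, hlt, h⟩
  have := hS hx hy hz h
  omega

/-- Two sets of natural numbers without 3-term progressions that agree up to a threshold, and that
beyond it omit only numbers they cover, are equal. -/
theorem ThreeAPFree.eq_of_isCoveredBy {B C : Set ℕ} {P : ℕ → Prop} (hB : ThreeAPFree B)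
    (hC : ThreeAPFree C) (hBC : ∀ x, ¬ P x → (x ∈ B ↔ x ∈ C))
    (hcovB : ∀ x, P x → x ∉ B → IsCoveredBy B x)
    (hcovC : ∀ x, P x → x ∉ C → IsCoveredBy C x) : B = C := by
  ext x
  induction x using Nat.strong_induction_on with
  | _ x ih =>
    by_cases hP : P x
    · constructor
      · intro hx
        by_contra hx'
        obtain ⟨z, hz, y, hy, hlt, h⟩ := hcovC x hP hx'
        exact hB.not_isCoveredBy hx
          ⟨z, (ih z (by omega)).2 hz, y, (ih y (by omega)).2 hy, hlt, h⟩
      · intro hx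
        by_contra hx'
        obtain ⟨z, hz, y, hy, hlt, h⟩ := hcovB x hP hx'
        exact hC.not_isCoveredBy hx
          ⟨z, (ih z (by omega)).1 hz, y, (ih y (by omega)).1 hy, hlt, h⟩
    · exact hBC x hP

theorem stanleyNext_spec {S : Finset ℕ} (hS : ThreeAPFree (S : Set ℕ)) :
    (∀ s ∈ S, s < stanleyNext S) ∧ ThreeAPFree (insert (stanleyNext S) (S : Set ℕ)) := by
  have hle : ∀ s ∈ S, s ≤ S.sup id := fun s hs ↦ Finset.le_sup (f := id) hs
  have hlt : ∀ s ∈ S, s < 2 * S.sup id + 1 := fun s hs ↦ by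
    have := hle s hs
    omega
  refine Nat.sInf_mem (s := {x : ℕ | (∀ s ∈ S, s < x) ∧ ThreeAPFree (insert x (S : Set ℕ))})
    ⟨2 * S.sup id + 1, hlt, threeAPFree_insert_of_not_isCoveredBy hS hlt ?_⟩
  rintro ⟨z, -, y, hy, -, h⟩
  have := hle y hy
  omega

theorem isCoveredBy_of_lt_stanleyNext {S : Finset ℕ} {x : ℕ} (hS : ThreeAPFree (S : Set ℕ))
    (hlt : ∀ s ∈ S, s < x) (hx : x < stanleyNext S) : IsCoveredBy S x := by
  by_contra h
  exact Nat.notMem_of_lt_sInf hx ⟨hlt, threeAPFree_insert_of_not_isCoveredBy hS hlt h⟩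

section StanleyIter

variable {A : Finset ℕ}

theorem stanleyIter_mono (A : Finset ℕ) : Monotone (stanleyIter A) :=
  monotone_nat_of_le_succ fun _ ↦ Finset.subset_insert _ _

theorem mem_stanleySet {x : ℕ} : x ∈ stanleySet A ↔ ∃ n, x ∈ stanleyIter A n := by
  simp [stanleySet]

theorem threeAPFree_stanleyIter (hA : ThreeAPFree (A : Set ℕ)) (n : ℕ) :
    ThreeAPFree (stanleyIter A n : Set ℕ) := by
  induction n with
  | zero => exact hA
  | succ n ih => simpa [stanleyIter] using (stanleyNext_spec ih).2

theorem threeAPFree_stanleySet (hA : ThreeAPFree (A : Set ℕ)) : ThreeAPFree (stanleySet A) := by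
  intro a ha b hb c hc h
  obtain ⟨i, hi⟩ := mem_stanleySet.1 ha
  obtain ⟨j, hj⟩ := mem_stanleySet.1 hb
  obtain ⟨k, hk⟩ := mem_stanleySet.1 hc
  exact threeAPFree_stanleyIter hA (i + j + k)
    (stanleyIter_mono A (by omega : i ≤ i + j + k) hi)
    (stanleyIter_mono A (by omega : j ≤ i + j + k) hj)
    (stanleyIter_mono A (by omega : k ≤ i + j + k) hk) h

theorem subset_stanleySet (A : Finset ℕ) : (A : Set ℕ) ⊆ stanleySet A :=
  fun _ hx ↦ mem_stanleySet.2 ⟨0, hx⟩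

theorem mem_or_lt_of_mem_stanleySet (hA : ThreeAPFree (A : Set ℕ)) {x : ℕ}
    (hx : x ∈ stanleySet A) : x ∈ A ∨ ∀ a ∈ A, a < x := by
  obtain ⟨n, hn⟩ := mem_stanleySet.1 hx
  induction n with
  | zero => exact .inl hn
  | succ n ih =>
    rcases Finset.mem_insert.1 hn with rfl | hn
    · exact .inr fun a ha ↦ (stanleyNext_spec (threeAPFree_stanleyIter hA n)).1 a
        (stanleyIter_mono A n.zero_le ha)
    · exact ih hn

theorem le_stanleyNext_stanleyIter (hA : ThreeAPFree (A : Set ℕ)) (n : ℕ) :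
    n ≤ stanleyNext (stanleyIter A n) := by
  induction n with
  | zero => exact Nat.zero_le _
  | succ n ih =>
    exact ih.trans_lt ((stanleyNext_spec (threeAPFree_stanleyIter hA (n + 1))).1 _
      (Finset.mem_insert_self _ _))

theorem isCoveredBy_stanleySet (hA : ThreeAPFree (A : Set ℕ)) {x : ℕ} (hlt : ∀ a ∈ A, a < x)
    (hx : x ∉ stanleySet A) : IsCoveredBy (stanleySet A) x := by
  classical
  have hex : ∃ n, x < stanleyNext (stanleyIter A n) :=
    ⟨x + 1, le_stanleyNext_stanleyIter hA (x + 1)⟩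
  have hlt' : ∀ n ≤ Nat.find hex, ∀ s ∈ stanleyIter A n, s < x := by
    intro n
    induction n with
    | zero => exact fun _ ↦ hlt
    | succ n ih =>
      intro hn s hs
      rcases Finset.mem_insert.1 hs with rfl | hs'
      · refine lt_of_le_of_ne (not_lt.1 (Nat.find_min hex hn)) ?_
        rintro rfl
        exact hx (mem_stanleySet.2 ⟨n + 1, hs⟩)
      · exact ih (by omega) s hs'
  obtain ⟨z, hz, y, hy, h⟩ := isCoveredBy_of_lt_stanleyNext
    (threeAPFree_stanleyIter hA _) (hlt' _ le_rfl) (Nat.find_spec hex)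
  exact ⟨z, mem_stanleySet.2 ⟨_, hz⟩, y, mem_stanleySet.2 ⟨_, hy⟩, h⟩

end StanleyIter

namespace NearModular

variable {A S : Set ℕ} {N : ℕ}

theorem eq_of_add_mul_eq (hA : NearModular A N) {a b c r s t : ℕ} (ha : a ∈ A) (hb : b ∈ A)
    (hc : c ∈ A) (h : (a + N * r) + (c + N * t) = (b + N * s) + (b + N * s)) :
    a = b ∧ b = c := by
  refine hA.2.1 a ha b hb c hc (Int.modEq_iff_dvd.2 ⟨(r : ℤ) + t - 2 * s, ?_⟩)
  zify at h
  linear_combination -h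

theorem threeAPFree_s4 (hA : NearModular A N) : ThreeAPFree A := fun _ ha _ hb _ hc h ↦
  (hA.eq_of_add_mul_eq (r := 0) (s := 0) (t := 0) ha hb hc (by simpa using h)).1

theorem threeAPFree_add_mul (hA : NearModular A N) (hN : 0 < N) (hS : ThreeAPFree S) :
    ThreeAPFree {x : ℕ | ∃ a ∈ A, ∃ s ∈ S, x = a + N * s} := by
  rintro _ ⟨a, ha, r, hr, rfl⟩ _ ⟨b, hb, s, hs, rfl⟩ _ ⟨c, hc, t, ht, rfl⟩ h
  obtain ⟨rfl, rfl⟩ := hA.eq_of_add_mul_eq ha hb hc h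
  rw [hS hr hs ht (Nat.eq_of_mul_eq_mul_left hN (by linarith))]

theorem isCoveredBy_add_mul (hA : NearModular A N) (hAN : ∀ a ∈ A, a < N)
    (hS : ∀ x, x ∉ S → IsCoveredBy S x) {x : ℕ} (hlt : ∀ a ∈ A, a < x)
    (hx : x ∉ {x : ℕ | ∃ a ∈ A, ∃ s ∈ S, x = a + N * s}) :
    IsCoveredBy {x : ℕ | ∃ a ∈ A, ∃ s ∈ S, x = a + N * s} x := by
  obtain ⟨y, hy, z, hz, hzy, h⟩ := hA.2.2 x
  obtain ⟨k, hk⟩ := Int.modEq_iff_dvd.1 h.symm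
  have hyx := hlt y hy
  have hyN := hAN y hy
  have hk0 : 0 ≤ k := by
    by_contra! hneg
    nlinarith
  lift k to ℕ using hk0
  have hk' : x + z = y + y + N * k := by
    zify
    linear_combination hk
  by_cases hkS : k ∈ S
  · have hne : z ≠ y := by
      rintro rfl
      exact hx ⟨z, hz, k, hkS, by omega⟩
    exact ⟨_, ⟨z, hz, k, hkS, rfl⟩, _, ⟨y, hy, k, hkS, rfl⟩, by omega, by omega⟩
  · obtain ⟨s, hs, t, ht, hst, he⟩ := hS k hkS
    refine ⟨_, ⟨z, hz, s, hs, rfl⟩, _, ⟨y, hy, t, ht, rfl⟩, ?_, ?_⟩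
    · exact add_lt_add_of_le_of_lt hzy (Nat.mul_lt_mul_of_pos_left hst (by omega))
    · linear_combination hk' + N * he

end NearModular

/-- If `A` is a modular set mod `N`, then the set of terms of `S(A)` equals
`A + N · S(0)`. -/
theorem stanleySet_of_modular (N : ℕ) (hN : 0 < N) (A : Finset ℕ)
    (hA : IsModularSet A N) :
    stanleySet A = {x : ℕ | ∃ a ∈ A, ∃ s ∈ stanleySet {0}, x = a + N * s} := by
  obtain ⟨hAN, hmod⟩ := hA
  have h0 : ThreeAPFree (({0} : Finset ℕ) : Set ℕ) := by simp
  have hzero : 0 ∈ stanleySet {0} := subset_stanleySet _ (by simp)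
  have hcov : ∀ x, x ∉ stanleySet {0} → IsCoveredBy (stanleySet {0}) x := fun x hx ↦
    isCoveredBy_stanleySet h0 (by
      simpa [Nat.pos_iff_ne_zero] using fun h : x = 0 ↦ hx (h ▸ hzero)) hx
  refine (threeAPFree_stanleySet hmod.threeAPFree_s4).eq_of_isCoveredBy (P := fun x ↦ ∀ a ∈ A, a < x)
    (hmod.threeAPFree_add_mul hN (threeAPFree_stanleySet h0)) (fun x hx ↦ ?_)
    (fun x hx ↦ isCoveredBy_stanleySet hmod.threeAPFree_s4 hx)
    (fun x hx ↦ hmod.isCoveredBy_add_mul hAN hcov hx)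
  constructor
  · intro h
    exact ⟨x, (mem_or_lt_of_mem_stanleySet hmod.threeAPFree_s4 h).resolve_right hx, 0, hzero, by simp⟩
  · rintro ⟨a, ha, s, -, rfl⟩
    push Not at hx
    obtain ⟨b, hb, hle⟩ := hx
    have hs : s = 0 := by
      by_contra hs
      have := hAN b hb
      have := Nat.le_mul_of_pos_right N (Nat.pos_of_ne_zero hs)
      omega
    simpa [hs] using subset_stanleySet A ha
end

section
/- Let B = (b_k)_{k≥0} be a sequence of positive integers such that 3^k is the largest power of 3 dividing b_k for every k, and b_k = 3^k for all sufficiently large k. Then the set { Σ_{k≥0} δ_k·b_k : δ_k ∈ {0,1}, only finitely many δ_k nonzero } is the set of terms of a Stanley sequence (i.e., B is a valid basis). -/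
/-- If `S` is the part of `T` up to `m`, every later number outside `T` is blocked by a
progression with two terms in `T`, then the greedy extension of `S` is the next element of `T`. -/
theorem stanleyNext_eq_of_isLeast {T : Set ℕ} (hT : ThreeAPFree T) {S : Finset ℕ} {m t : ℕ}
    (hcov : ∀ x > m, x ∉ T → ∃ y ∈ T, ∃ z ∈ T, z < y ∧ x + z = 2 * y)
    (hS : ∀ s, s ∈ S ↔ s ∈ T ∧ s ≤ m) (hm : m ∈ T) (ht : IsLeast {t | t ∈ T ∧ m < t} t) :
    stanleyNext S = t := by
  refine IsLeast.csInf_eq ⟨⟨fun s hs => ((hS s).1 hs).2.trans_lt ht.1.2, hT.mono ?_⟩, ?_⟩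
  · rintro s (rfl | hs)
    · exact ht.1.1
    · exact ((hS s).1 hs).1
  · rintro x ⟨hx, hfree⟩
    by_contra! hlt
    have hmx : m < x := hx m ((hS m).2 ⟨hm, le_rfl⟩)
    have mem_S : ∀ y ∈ T, y < x → y ∈ S := fun y hy hyx => by
      refine (hS y).2 ⟨hy, ?_⟩
      by_contra! h
      exact absurd (ht.2 ⟨hy, h⟩) (by omega)
    have hxT : x ∉ T := fun h => absurd (ht.2 ⟨h, hmx⟩) (by omega)
    obtain ⟨y, hy, z, hz, hzy, he⟩ := hcov x hmx hxT
    have := hfree (Set.mem_insert_of_mem _ (mem_S z hz (by omega)))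
      (Set.mem_insert_of_mem _ (mem_S y hy (by omega))) (Set.mem_insert _ _) (by omega)
    omega

/-- An infinite progression-free set that blocks all numbers outside it beyond some `N ∈ T`
is the Stanley sequence generated by its elements up to `N`. -/
theorem stanleySet_eq_of_forall_exists {T : Set ℕ} (hT : ThreeAPFree T) (hinf : T.Infinite)
    {N : ℕ} (hN : N ∈ T)
    (hcov : ∀ x > N, x ∉ T → ∃ y ∈ T, ∃ z ∈ T, z < y ∧ x + z = 2 * y)
    {A : Finset ℕ} (hA : ∀ s, s ∈ A ↔ s ∈ T ∧ s ≤ N) :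
    stanleySet A = T := by
  have key : ∀ n, ∃ m ∈ T, N ≤ m ∧ n ≤ m ∧ ∀ s, s ∈ stanleyIter A n ↔ s ∈ T ∧ s ≤ m := by
    intro n
    induction n with
    | zero => exact ⟨N, hN, le_rfl, Nat.zero_le _, hA⟩
    | succ n ih =>
      obtain ⟨m, hm, hNm, hnm, hS⟩ := ih
      have hne : {t | t ∈ T ∧ m < t}.Nonempty := hinf.exists_gt m
      have hleast : IsLeast {t | t ∈ T ∧ m < t} (sInf {t | t ∈ T ∧ m < t}) :=
        ⟨Nat.sInf_mem hne, fun _ h => Nat.sInf_le h⟩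
      generalize sInf {t | t ∈ T ∧ m < t} = t at hleast
      have hmt : m < t := hleast.1.2
      refine ⟨t, hleast.1.1, by omega, by omega, fun s => ?_⟩
      rw [stanleyIter, stanleyNext_eq_of_isLeast hT (fun x hx => hcov x (by omega)) hS hm hleast,
        Finset.mem_insert, hS]
      constructor
      · rintro (rfl | ⟨h, h'⟩)
        · exact ⟨hleast.1.1, le_rfl⟩
        · exact ⟨h, by omega⟩
      · rintro ⟨h, h'⟩
        by_cases hsm : s ≤ m
        · exact Or.inr ⟨h, hsm⟩
        · exact Or.inl (le_antisymm h' (hleast.2 ⟨h, not_le.1 hsm⟩))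
  ext x
  rw [stanleySet, Set.mem_iUnion]
  constructor
  · rintro ⟨n, hn⟩
    obtain ⟨m, -, -, -, hS⟩ := key n
    exact ((hS x).1 hn).1
  · intro hx
    obtain ⟨m, -, -, hxm, hS⟩ := key x
    exact ⟨x, (hS x).2 ⟨hx, hxm⟩⟩

theorem exists_eq_three_pow_mul {b : ℕ → ℕ}
    (hdvd : ∀ k, 3 ^ k ∣ b k ∧ ¬ 3 ^ (k + 1) ∣ b k) (k : ℕ) : ∃ c, b k = 3 ^ k * c ∧ ¬ 3 ∣ c := by
  obtain ⟨⟨c, hc⟩, h⟩ := hdvd k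
  refine ⟨c, hc, fun h3 => h ?_⟩
  rw [hc, pow_succ]
  exact mul_dvd_mul_left _ h3

theorem coeff_eq_zero_of_sum_eq_zero {b : ℕ → ℕ}
    (hdvd : ∀ k, 3 ^ k ∣ b k ∧ ¬ 3 ^ (k + 1) ∣ b k) (U : Finset ℕ) (c : ℕ → ℤ)
    (hc : ∀ i, 3 ∣ c i → c i = 0) (hsum : ∑ i ∈ U, c i * b i = 0) :
    ∀ k ∈ U, c k = 0 := by
  intro k
  induction k using Nat.strong_induction_on with
  | _ k ih =>
    intro hk
    rw [← Finset.add_sum_erase U _ hk] at hsum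
    have hrest : (3 : ℤ) ^ (k + 1) ∣ ∑ i ∈ U.erase k, c i * b i := by
      refine Finset.dvd_sum fun i hi => ?_
      obtain ⟨hik, hiU⟩ := Finset.mem_erase.1 hi
      rcases lt_or_gt_of_ne hik with h | h
      · simp [ih i h hiU]
      · refine Dvd.dvd.mul_left ?_ _
        exact_mod_cast (pow_dvd_pow 3 h).trans (hdvd i).1
    obtain ⟨d, hd, h3⟩ := exists_eq_three_pow_mul hdvd k
    have hkd : (3 : ℤ) ^ (k + 1) ∣ c k * b k :=
      (dvd_add_left hrest).1 (hsum ▸ dvd_zero _)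
    rw [hd, Nat.cast_mul, Nat.cast_pow, mul_left_comm, pow_succ] at hkd
    have h := (mul_dvd_mul_iff_left (by positivity)).1 hkd
    rcases Int.prime_three.dvd_or_dvd h with h | h
    · exact hc k h
    · exact absurd (by exact_mod_cast h) h3

theorem threeAPFree_subset_sums {b : ℕ → ℕ}
    (hdvd : ∀ k, 3 ^ k ∣ b k ∧ ¬ 3 ^ (k + 1) ∣ b k) :
    ThreeAPFree {x : ℕ | ∃ F : Finset ℕ, x = ∑ k ∈ F, b k} := by
  rintro _ ⟨F, rfl⟩ _ ⟨G, rfl⟩ _ ⟨H, rfl⟩ he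
  set U := F ∪ G ∪ H with hU
  have hind : ∀ E ⊆ U, ((∑ k ∈ E, b k : ℕ) : ℤ) = ∑ k ∈ U, (if k ∈ E then 1 else 0) * (b k : ℤ) := by
    intro E hE
    simp [ite_mul, Finset.inter_eq_right.2 hE]
  have hF : F ⊆ U := fun x hx => by simp [hU, hx]
  have hG : G ⊆ U := fun x hx => by simp [hU, hx]
  have hH : H ⊆ U := fun x hx => by simp [hU, hx]
  have he' : ((∑ k ∈ F, b k : ℕ) : ℤ) + (∑ k ∈ H, b k : ℕ) - 2 * (∑ k ∈ G, b k : ℕ) = 0 := by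
    omega
  rw [hind F hF, hind G hG, hind H hH, Finset.mul_sum, ← Finset.sum_add_distrib,
    ← Finset.sum_sub_distrib] at he'
  have hzero := coeff_eq_zero_of_sum_eq_zero hdvd U
    (fun k => (if k ∈ F then 1 else 0) + (if k ∈ H then 1 else 0) - 2 * (if k ∈ G then 1 else 0))
    (fun i => by split_ifs <;> decide)
    (by simpa only [sub_mul, add_mul, mul_assoc] using he')
  congr 1
  ext k
  by_cases hk : k ∈ U
  · have := hzero k hk
    split_ifs at this <;> simp_all
  · exact ⟨fun h => absurd (hF h) hk, fun h => absurd (hG h) hk⟩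

theorem exists_sums_dvd_sub {b : ℕ → ℕ}
    (hdvd : ∀ k, 3 ^ k ∣ b k ∧ ¬ 3 ^ (k + 1) ∣ b k) (x : ℤ) (n : ℕ) : ∃ F ⊆ Finset.range n, ∃ G ⊆ F,
    (3 : ℤ) ^ n ∣ x - (2 * ∑ k ∈ F, (b k : ℤ) - ∑ k ∈ G, (b k : ℤ)) := by
  induction n with
  | zero => exact ⟨∅, by simp, ∅, by simp, by simp⟩
  | succ n ih =>
    obtain ⟨F, hF, G, hG, q, hq⟩ := ih
    have hnF : n ∉ F := fun h => by simpa using hF h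
    have hnG : n ∉ G := fun h => hnF (hG h)
    have hFs : F ⊆ Finset.range (n + 1) := hF.trans (Finset.range_mono n.le_succ)
    have hFi : insert n F ⊆ Finset.range (n + 1) := Finset.insert_subset (by simp) hFs
    obtain ⟨c, hc, h3⟩ := exists_eq_three_pow_mul hdvd n
    have hc' : (b n : ℤ) = 3 ^ n * c := by exact_mod_cast hc
    have hcases : (3 : ℤ) ∣ q ∨ (3 : ℤ) ∣ q - c ∨ (3 : ℤ) ∣ q - 2 * c := by
      have hc3 : (c : ℤ) % 3 = 1 ∨ (c : ℤ) % 3 = 2 := by omega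
      have hq3 : q % 3 = 0 ∨ q % 3 = 1 ∨ q % 3 = 2 := by omega
      omega
    rcases hcases with ⟨r, hr⟩ | ⟨r, hr⟩ | ⟨r, hr⟩
    · refine ⟨F, hFs, G, hG, r, ?_⟩
      rw [hq, hr]; ring
    · refine ⟨insert n F, hFi, insert n G, Finset.insert_subset_insert n hG, r, ?_⟩
      rw [Finset.sum_insert hnF, Finset.sum_insert hnG, hc']
      linear_combination hq + 3 ^ n * hr
    · refine ⟨insert n F, hFi, G, hG.trans (Finset.subset_insert n F), r, ?_⟩
      rw [Finset.sum_insert hnF, hc']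
      linear_combination hq + 3 ^ n * hr

theorem exists_sums_eq_three_pow_mul {b : ℕ → ℕ} {K : ℕ} (hK : ∀ k ≥ K, b k = 3 ^ k) (q : ℕ) :
    ∀ k ≥ K, ∃ F : Finset ℕ, (∀ i ∈ F, k ≤ i) ∧ ∃ G ⊆ F,
      3 ^ k * q + ∑ i ∈ G, b i = 2 * ∑ i ∈ F, b i := by
  induction q using Nat.strong_induction_on with
  | _ q ih =>
    intro k hk
    rcases Nat.eq_zero_or_pos q with rfl | hq
    · exact ⟨∅, by simp, ∅, by simp, by simp⟩
    obtain ⟨F, hF, G, hG, he⟩ := ih (q / 3) (by omega) (k + 1) (by omega)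
    have hkF : k ∉ F := fun h => by simpa using hF k h
    have hkG : k ∉ G := fun h => hkF (hG h)
    have hFk : ∀ i ∈ F, k ≤ i := fun i hi => (Nat.le_succ k).trans (hF i hi)
    have hFi : ∀ i ∈ insert k F, k ≤ i := by simpa using hFk
    have hbk := hK k hk
    have hcases : q = 3 * (q / 3) ∨ q = 3 * (q / 3) + 1 ∨ q = 3 * (q / 3) + 2 := by omega
    rcases hcases with hr | hr | hr
    · refine ⟨F, hFk, G, hG, ?_⟩
      rw [← he]
      conv_lhs => rw [hr]
      ring
    · refine ⟨insert k F, hFi, insert k G, Finset.insert_subset_insert k hG, ?_⟩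
      rw [Finset.sum_insert hkF, Finset.sum_insert hkG, mul_add 2, ← he, hbk]
      conv_lhs => rw [hr]
      ring
    · refine ⟨insert k F, hFi, G, hG.trans (Finset.subset_insert k F), ?_⟩
      rw [Finset.sum_insert hkF, mul_add 2, ← he, hbk]
      conv_lhs => rw [hr]
      ring

theorem exists_sums_of_le {b : ℕ → ℕ} (hdvd : ∀ k, 3 ^ k ∣ b k ∧ ¬ 3 ^ (k + 1) ∣ b k)
    {K : ℕ} (hK : ∀ k ≥ K, b k = 3 ^ k) {x : ℕ} (hx : 2 * ∑ k ∈ Finset.range K, b k ≤ x) :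
    ∃ F : Finset ℕ, ∃ G ⊆ F, x + ∑ i ∈ G, b i = 2 * ∑ i ∈ F, b i := by
  obtain ⟨F, hF, G, hG, q, hq⟩ := exists_sums_dvd_sub hdvd x K
  have hFle : ∑ k ∈ F, b k ≤ ∑ k ∈ Finset.range K, b k := Finset.sum_le_sum_of_subset hF
  rw [← Nat.cast_sum, ← Nat.cast_sum] at hq
  have hq0 : 0 ≤ q := by
    refine nonneg_of_mul_nonneg_right (a := (3 : ℤ) ^ K) ?_ (by positivity)
    rw [← hq]; omega
  lift q to ℕ using hq0
  obtain ⟨F', hF', G', hG', he⟩ := exists_sums_eq_three_pow_mul hK q K le_rfl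
  have hdF : Disjoint F F' := Finset.disjoint_left.2 fun i hi hi' =>
    absurd (Finset.mem_range.1 (hF hi)) (not_lt.2 (hF' i hi'))
  refine ⟨F ∪ F', G ∪ G', Finset.union_subset_union hG hG', ?_⟩
  rw [Finset.sum_union hdF, Finset.sum_union (hdF.mono hG hG')]
  zify at he ⊢
  push_cast at hq
  linear_combination hq + he

/-- If `3^k` is the exact power of `3` dividing `b k` for every `k` and
`b k = 3^k` for large `k`, then `{Σ_{k ∈ F} b k : F finite}` is the set of terms of a
Stanley sequence. -/
theorem valid_basis (b : ℕ → ℕ) (hpos : ∀ k, 0 < b k)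
    (hdvd : ∀ k, 3 ^ k ∣ b k ∧ ¬ 3 ^ (k + 1) ∣ b k)
    (hev : ∃ K, ∀ k ≥ K, b k = 3 ^ k) :
    ∃ A : Finset ℕ, 0 ∈ A ∧ ThreeAPFree (A : Set ℕ) ∧
      stanleySet A = {x : ℕ | ∃ F : Finset ℕ, x = ∑ k ∈ F, b k} := by
  classical
  obtain ⟨K, hK⟩ := hev
  set T : Set ℕ := {x : ℕ | ∃ F : Finset ℕ, x = ∑ k ∈ F, b k} with hTdef
  have hT : ThreeAPFree T := threeAPFree_subset_sums hdvd
  have hpow : ∀ k ≥ K, 3 ^ k ∈ T := fun k hk => ⟨{k}, by simp [hK k hk]⟩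
  have hunb : ∀ n, ∃ t ∈ T, n < t := fun n =>
    ⟨3 ^ (n + K), hpow _ (by omega), (Nat.lt_pow_self (by norm_num)).trans_le
      (Nat.pow_le_pow_right (by norm_num) (by omega))⟩
  obtain ⟨N, hN, hNlt⟩ := hunb (2 * ∑ k ∈ Finset.range K, b k)
  have hA : ∀ s, s ∈ (Finset.range (N + 1)).filter (· ∈ T) ↔ s ∈ T ∧ s ≤ N := by
    intro s
    rw [Finset.mem_filter, Finset.mem_range, Nat.lt_succ_iff, and_comm]
  refine ⟨(Finset.range (N + 1)).filter (· ∈ T), (hA 0).2 ⟨⟨∅, by simp⟩, Nat.zero_le _⟩,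
    hT.mono fun s hs => ((hA s).1 hs).1, ?_⟩
  refine stanleySet_eq_of_forall_exists hT (Set.infinite_of_forall_exists_gt hunb) hN ?_ hA
  intro x hx hxT
  obtain ⟨F, G, hG, he⟩ := exists_sums_of_le hdvd hK (hNlt.trans hx).le
  refine ⟨_, ⟨F, rfl⟩, _, ⟨G, rfl⟩, lt_of_le_of_ne (Finset.sum_le_sum_of_subset hG) fun h => ?_, he⟩
  exact hxT ⟨F, by omega⟩
end

section
/- Suppose A is a near-modular set with respect to 3^ℓ for some ℓ ≥ 1 with |A| = 2^ℓ, and (b_k)_{k≥0} is a sequence of positive integers such that 3^{k+ℓ} is the largest power of three dividing b_k for every k. Let n_0 be an index such that b_n = 3^{n+ℓ} for all n ≥ n_0 and b_{n_0} > max(A) + Σ_{k=0}^{n_0−1} b_k. Then L = { a + Σ_{k=0}^{n_0−1} δ_k·b_k : a ∈ A, δ_k ∈ {0,1} } is a modular set mod 3^{n_0+ℓ}. -/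
/-- Adjoining a translate by `N * u`, where `u` is not divisible by three, turns a
near-modular set with respect to `N` into one with respect to `3 * N`. -/
theorem NearModular.add_translate {A : Set ℕ} {N u : ℕ} (hA : NearModular A N) (hN : 0 < N)
    (hu : ¬ 3 ∣ u) :
    NearModular {x : ℕ | ∃ a ∈ A, ∃ e ≤ 1, x = a + e * (N * u)} (3 * N) := by
  obtain ⟨h0, hfree, hcov⟩ := hA
  have hNz : (N : ℤ) ≠ 0 := by exact_mod_cast hN.ne'
  have hu' : (u : ℤ) % 3 = 1 ∨ (u : ℤ) % 3 = 2 := by omega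
  refine ⟨⟨0, h0, 0, by simp, by simp⟩, ?_, ?_⟩
  · rintro _ ⟨x, hx, i, hi, rfl⟩ _ ⟨y, hy, j, hj, rfl⟩ _ ⟨z, hz, k, hk, rfl⟩ h
    rw [Int.modEq_iff_dvd] at h
    obtain ⟨t, ht⟩ := h
    push_cast at ht
    obtain ⟨rfl, rfl⟩ := hfree x hx y hy z hz (by
      rw [Int.modEq_iff_dvd]
      exact ⟨3 * t - (2 * j - k - i) * u, by linear_combination ht⟩)
    have h3 : (2 * (j : ℤ) - k - i) * u = 3 * t :=
      mul_left_cancel₀ hNz (by linear_combination ht)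
    interval_cases i <;> interval_cases j <;> interval_cases k <;> first
      | exact ⟨rfl, rfl⟩
      | (exfalso; push_cast at h3; omega)
  · intro x
    obtain ⟨y, hy, z, hz, hzy, h⟩ := hcov x
    rw [Int.modEq_iff_dvd] at h
    obtain ⟨t, ht⟩ := h
    obtain ⟨j, hj, k, hkj, s, hs⟩ : ∃ j ≤ 1, ∃ k ≤ j, (3 : ℤ) ∣ t + (2 * (j : ℕ) - (k : ℕ)) * u := by
      have : t % 3 = 0 ∨ (t + u) % 3 = 0 ∨ (t + 2 * u) % 3 = 0 := by omega
      rcases this with h | h | h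
      · exact ⟨0, by simp, 0, by simp, by push_cast; omega⟩
      · exact ⟨1, by simp, 1, by simp, by push_cast; omega⟩
      · exact ⟨1, by simp, 0, by simp, by push_cast; omega⟩
    refine ⟨_, ⟨y, hy, j, hj, rfl⟩, _, ⟨z, hz, k, hkj.trans hj, rfl⟩, by gcongr, ?_⟩
    rw [Int.modEq_iff_dvd]
    exact ⟨s, by push_cast; linear_combination ht + N * hs⟩

/-- Adjoining all subset sums of `b 0, …, b (n - 1)`, where `3 ^ (k + l)` exactly divides `b k`,
turns a near-modular set with respect to `3 ^ l` into one with respect to `3 ^ (n + l)`. -/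
theorem NearModular.add_subset_sums {A : Set ℕ} {l : ℕ} (hA : NearModular A (3 ^ l)) {b : ℕ → ℕ}
    (hdvd : ∀ k, 3 ^ (k + l) ∣ b k ∧ ¬ 3 ^ (k + l + 1) ∣ b k) (n : ℕ) :
    NearModular {x : ℕ | ∃ a ∈ A, ∃ δ : ℕ → ℕ, (∀ k, δ k ≤ 1) ∧
      x = a + ∑ k ∈ Finset.range n, δ k * b k} (3 ^ (n + l)) := by
  induction n with
  | zero =>
    convert hA using 1
    · ext x
      constructor
      · rintro ⟨a, ha, -, -, rfl⟩
        simpa using ha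
      · exact fun hx => ⟨x, hx, 0, by simp, by simp⟩
    · simp
  | succ n ih =>
    obtain ⟨⟨u, hu⟩, hndvd⟩ := hdvd n
    have hu3 : ¬ 3 ∣ u := by
      intro h
      rw [hu, pow_succ] at hndvd
      exact hndvd (mul_dvd_mul_left _ h)
    convert ih.add_translate (by positivity) hu3 using 1
    · ext x
      simp only [Set.mem_ofPred_eq]
      constructor
      · rintro ⟨a, ha, δ, hδ, rfl⟩
        exact ⟨_, ⟨a, ha, δ, hδ, rfl⟩, δ n, hδ n, by rw [Finset.sum_range_succ, ← hu, add_assoc]⟩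
      · rintro ⟨_, ⟨a, ha, δ, hδ, rfl⟩, e, he, rfl⟩
        refine ⟨a, ha, Function.update δ n e, fun k => ?_, ?_⟩
        · rcases eq_or_ne k n with rfl | hk
          · simpa using he
          · simpa [hk] using hδ k
        · rw [Finset.sum_range_succ, ← hu, Function.update_self, add_assoc]
          congr 2
          refine Finset.sum_congr rfl fun k hk => ?_
          rw [Function.update_of_ne (Finset.mem_range.mp hk).ne]
    · ring


/-- With `A` near-modular mod `3^ℓ`, `|A| = 2^ℓ`, `(b k)` with exact power
of three `3^(k+ℓ)`, `b n = 3^(n+ℓ)` for `n ≥ n₀`, and `b n₀ > max A + Σ_{k<n₀} b k`, the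
set `L = {a + Σ_{k<n₀} δ k * b k : a ∈ A, δ k ∈ {0,1}}` is a modular set mod `3^(n₀+ℓ)`. -/
theorem L_isModularSet (ℓ : ℕ) (hℓ : 1 ≤ ℓ) (A : Finset ℕ) (hA0 : A.Nonempty)
    (hA : NearModular (A : Set ℕ) (3 ^ ℓ)) (hcard : A.card = 2 ^ ℓ)
    (b : ℕ → ℕ) (hpos : ∀ k, 0 < b k)
    (hdvd : ∀ k, 3 ^ (k + ℓ) ∣ b k ∧ ¬ 3 ^ (k + ℓ + 1) ∣ b k)
    (n0 : ℕ) (hn0 : ∀ n ≥ n0, b n = 3 ^ (n + ℓ))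
    (hbig : A.max' hA0 + ∑ k ∈ Finset.range n0, b k < b n0)
    (L : Finset ℕ)
    (hL : (L : Set ℕ) = {x : ℕ | ∃ a ∈ A, ∃ δ : ℕ → ℕ, (∀ k, δ k ≤ 1) ∧
      x = a + ∑ k ∈ Finset.range n0, δ k * b k}) :
    IsModularSet L (3 ^ (n0 + ℓ)) := by
  refine ⟨fun x hx => ?_, hL ▸ hA.add_subset_sums hdvd n0⟩
  rw [← Finset.mem_coe, hL] at hx
  obtain ⟨a, ha, δ, hδ, rfl⟩ := hx
  rw [← hn0 n0 le_rfl]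
  refine lt_of_le_of_lt (add_le_add (A.le_max' a ha) (Finset.sum_le_sum fun k _ => ?_)) hbig
  simpa using Nat.mul_le_mul_right (b k) (hδ k)
end

section
/- For every nonnegative integer j, the sets A_1^j = {0, 2, 5, 6 + 9j} and B_1^j = {0, 4, 10, 12 + 9j} are near-modular with respect to 9. -/
/-- `A₁ʲ = {0, 2, 5, 6 + 9j}` and `B₁ʲ = {0, 4, 10, 12 + 9j}` are
near-modular with respect to `9`. -/
theorem A1_B1_nearModular (j : ℕ) :
    NearModular ({0, 2, 5, 6 + 9 * j} : Set ℕ) 9 ∧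
    NearModular ({0, 4, 10, 12 + 9 * j} : Set ℕ) 9 := by
  constructor
  · refine ⟨by simp, ?_, fun x ↦ ?_⟩
    · simp only [Set.mem_insert_iff, Set.mem_singleton_iff, Int.ModEq]
      rintro x (rfl | rfl | rfl | rfl) y (rfl | rfl | rfl | rfl) z (rfl | rfl | rfl | rfl) h <;>
        push_cast at h <;> omega
    have hx : x % 9 = 0 ∨ x % 9 = 1 ∨ x % 9 = 2 ∨ x % 9 = 3 ∨ x % 9 = 4 ∨ x % 9 = 5 ∨
        x % 9 = 6 ∨ x % 9 = 7 ∨ x % 9 = 8 := by omega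
    rcases hx with hx | hx | hx | hx | hx | hx | hx | hx | hx
    · exact ⟨0, by simp, 0, by simp, by omega, by push_cast [Int.ModEq]; omega⟩
    · exact ⟨5, by simp, 0, by simp, by omega, by push_cast [Int.ModEq]; omega⟩
    · exact ⟨2, by simp, 2, by simp, by omega, by push_cast [Int.ModEq]; omega⟩
    · exact ⟨6 + 9 * j, by simp, 0, by simp, by omega, by push_cast [Int.ModEq]; omega⟩
    · exact ⟨2, by simp, 0, by simp, by omega, by push_cast [Int.ModEq]; omega⟩
    · exact ⟨5, by simp, 5, by simp, by omega, by push_cast [Int.ModEq]; omega⟩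
    · exact ⟨6 + 9 * j, by simp, 6 + 9 * j, by simp, by omega, by push_cast [Int.ModEq]; omega⟩
    · exact ⟨6 + 9 * j, by simp, 5, by simp, by omega, by push_cast [Int.ModEq]; omega⟩
    · exact ⟨5, by simp, 2, by simp, by omega, by push_cast [Int.ModEq]; omega⟩
  · refine ⟨by simp, ?_, fun x ↦ ?_⟩
    · simp only [Set.mem_insert_iff, Set.mem_singleton_iff, Int.ModEq]
      rintro x (rfl | rfl | rfl | rfl) y (rfl | rfl | rfl | rfl) z (rfl | rfl | rfl | rfl) h <;>
        push_cast at h <;> omega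
    have hx : x % 9 = 0 ∨ x % 9 = 1 ∨ x % 9 = 2 ∨ x % 9 = 3 ∨ x % 9 = 4 ∨ x % 9 = 5 ∨
        x % 9 = 6 ∨ x % 9 = 7 ∨ x % 9 = 8 := by omega
    rcases hx with hx | hx | hx | hx | hx | hx | hx | hx | hx
    · exact ⟨0, by simp, 0, by simp, by omega, by push_cast [Int.ModEq]; omega⟩
    · exact ⟨10, by simp, 10, by simp, by omega, by push_cast [Int.ModEq]; omega⟩
    · exact ⟨10, by simp, 0, by simp, by omega, by push_cast [Int.ModEq]; omega⟩
    · exact ⟨12 + 9 * j, by simp, 12 + 9 * j, by simp, by omega, by push_cast [Int.ModEq]; omega⟩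
    · exact ⟨4, by simp, 4, by simp, by omega, by push_cast [Int.ModEq]; omega⟩
    · exact ⟨12 + 9 * j, by simp, 10, by simp, by omega, by push_cast [Int.ModEq]; omega⟩
    · exact ⟨12 + 9 * j, by simp, 0, by simp, by omega, by push_cast [Int.ModEq]; omega⟩
    · exact ⟨10, by simp, 4, by simp, by omega, by push_cast [Int.ModEq]; omega⟩
    · exact ⟨4, by simp, 0, by simp, by omega, by push_cast [Int.ModEq]; omega⟩
end

section
/- For every nonnegative integer j, the sets A_2^j = {0, 1, 4, 6, 10, 13, 15, 18 + 27j} and B_2^j = {0, 2, 8, 12, 20, 26, 30, 36 + 27j} are near-modular with respect to 27. -/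
/-- Near-modularity of a finite set is a finite condition on residues. -/
theorem nearModular_coe_of_mod {A : Finset ℕ} {N : ℕ} (hN : 0 < N) (h0 : 0 ∈ A)
    (hfree : ∀ x ∈ A, ∀ y ∈ A, ∀ z ∈ A, (x + z) % N = 2 * y % N → x = y ∧ y = z)
    (hcover : ∀ r < N, ∃ y ∈ A, ∃ z ∈ A, z ≤ y ∧ (r + z) % N = 2 * y % N) :
    NearModular (A : Set ℕ) N := by
  have key (x : ℤ) (y z : ℕ) : x ≡ 2 * (y : ℤ) - z [ZMOD N] ↔ x + z ≡ 2 * y [ZMOD N] :=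
    ⟨fun h => by simpa using h.add_right z, fun h => by simpa using h.sub_right z⟩
  refine ⟨h0, fun x hx y hy z hz h => hfree x hx y hy z hz ?_, fun x => ?_⟩
  · exact_mod_cast (key x y z).1 h
  · have hN' : (0 : ℤ) < N := by exact_mod_cast hN
    obtain ⟨r, hr⟩ := Int.eq_ofNat_of_zero_le (Int.emod_nonneg x hN'.ne')
    have hrN : r < N := by exact_mod_cast hr ▸ Int.emod_lt_of_pos x hN'
    obtain ⟨y, hy, z, hz, hzy, h⟩ := hcover r hrN
    refine ⟨y, hy, z, hz, hzy, (key x y z).2 ?_⟩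
    have hxr : x ≡ r [ZMOD N] := by rw [← hr]; exact (Int.mod_modEq x N).symm
    exact (hxr.add_right _).trans (by exact_mod_cast (Int.natCast_modEq_iff.2 h))

/-- Raising the largest element by a multiple of `N` preserves near-modularity mod `N`. -/
theorem NearModular.insert_add_mul {S : Set ℕ} {m N : ℕ} (h : NearModular (insert m S) N)
    (hm : ∀ s ∈ S, s < m) (h0 : 0 ∈ S) (j : ℕ) :
    NearModular (insert (m + N * j) S) N := by
  obtain ⟨-, hfree, hcover⟩ := h
  have down (x : ℕ) (hx : x ∈ insert (m + N * j) S) : ∃ x' ∈ insert m S,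
      (x' : ℤ) ≡ x [ZMOD N] ∧ (x = m + N * j ∧ x' = m ∨ x = x' ∧ x < m) := by
    rcases hx with rfl | hx
    · exact ⟨m, .inl rfl, by simp [Int.ModEq], .inl ⟨rfl, rfl⟩⟩
    · exact ⟨x, .inr hx, rfl, .inr ⟨rfl, hm x hx⟩⟩
  have up (x : ℕ) (hx : x ∈ insert m S) : ∃ x' ∈ insert (m + N * j) S,
      (x : ℤ) ≡ x' [ZMOD N] ∧ (x = m ∧ x' = m + N * j ∨ x = x' ∧ x < m) := by
    rcases hx with rfl | hx
    · exact ⟨x + N * j, .inl rfl, by simp [Int.ModEq], .inl ⟨rfl, rfl⟩⟩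
    · exact ⟨x, .inr hx, rfl, .inr ⟨rfl, hm x hx⟩⟩
  refine ⟨.inr h0, fun x hx y hy z hz hxyz => ?_, fun x => ?_⟩
  · obtain ⟨x', hx', hxx, hx⟩ := down x hx
    obtain ⟨y', hy', hyy, hy⟩ := down y hy
    obtain ⟨z', hz', hzz, hz⟩ := down z hz
    have := hfree x' hx' y' hy' z' hz'
      (hxx.trans (hxyz.trans ((hyy.mul_left 2).sub hzz).symm))
    omega
  · obtain ⟨y, hy, z, hz, hzy, hx⟩ := hcover x
    obtain ⟨y', hy', hyy, hy⟩ := up y hy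
    obtain ⟨z', hz', hzz, hz⟩ := up z hz
    exact ⟨y', hy', z', hz', by omega, hx.trans ((hyy.mul_left 2).sub hzz)⟩

theorem nearModular_A2_zero : NearModular ({18, 0, 1, 4, 6, 10, 13, 15} : Set ℕ) 27 := by
  have h := nearModular_coe_of_mod (A := {18, 0, 1, 4, 6, 10, 13, 15}) (N := 27)
    (by decide) (by decide) (by decide +kernel) (by decide +kernel)
  simpa using h

theorem nearModular_B2_zero : NearModular ({36, 0, 2, 8, 12, 20, 26, 30} : Set ℕ) 27 := by
  have h := nearModular_coe_of_mod (A := {36, 0, 2, 8, 12, 20, 26, 30}) (N := 27)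
    (by decide) (by decide) (by decide +kernel) (by decide +kernel)
  simpa using h

/-- `A₂ʲ` and `B₂ʲ` are near-modular with respect to `27`. -/
theorem A2_B2_nearModular (j : ℕ) :
    NearModular ({0, 1, 4, 6, 10, 13, 15, 18 + 27 * j} : Set ℕ) 27 ∧
    NearModular ({0, 2, 8, 12, 20, 26, 30, 36 + 27 * j} : Set ℕ) 27 := by
  constructor
  · convert nearModular_A2_zero.insert_add_mul (by simp) (by simp) j using 1
    ext x
    simp only [Set.mem_insert_iff, Set.mem_singleton_iff]
    tauto
  · convert nearModular_B2_zero.insert_add_mul (by simp) (by simp) j using 1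
    ext x
    simp only [Set.mem_insert_iff, Set.mem_singleton_iff]
    tauto
end
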